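/- arXiv:1408.2600 — 7 statements merged into one kernel-verified Lean document; each statement's English description precedes it below -/
import Mathlib

section
/- The real hyperbolic plane (Mathlib's upper half-plane `UpperHalfPlane` equipped with its hyperbolic metric) has strong negative type: it has negative type, and for every pair of Borel probability measures μ₁, μ₂ on it with finite first moment, the quantity ∫∫ d(x,y) d(μ₁−μ₂)(x) d(μ₁−μ₂)(y), i.e. ∫∫ d dμ₁dμ₁ + ∫∫ d dμ₂dμ₂ − 2∫∫ d dμ₁dμ₂, is ≤ 0, with equality only when μ₁ = μ₂. This is the n = 2 case of the paper's main theorem that real hyperbolic n-space has strong negative type. -/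
open MeasureTheory

noncomputable instance : MeasurableSpace UpperHalfPlane := borel UpperHalfPlane

instance : BorelSpace UpperHalfPlane := ⟨rfl⟩

open Filter Topology Set

namespace MeasureTheory

variable {X S : Type*} [MeasurableSpace S] {ρ : Measure S} {φ : X → S → ℝ}

theorem integral_add_sub_two_mul {f g h : S → ℝ} (hf : Integrable f ρ) (hg : Integrable g ρ)
    (hh : Integrable h ρ) :
    ∫ s, (f s + g s - 2 * h s) ∂ρ = (∫ s, f s ∂ρ) + (∫ s, g s ∂ρ) - 2 * ∫ s, h s ∂ρ := by
  have hfg : Integrable (fun s => f s + g s) ρ := hf.add hg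
  rw [integral_sub hfg (hh.const_mul 2), integral_add hf hg, integral_const_mul]

/-- A kernel of the form `∫ (φ x s - φ y s)² dρ(s)` is conditionally negative definite. -/
theorem sum_mul_integral_sq_sub_nonpos
    (hφ : ∀ x y, Integrable (fun s => (φ x s - φ y s) ^ 2) ρ)
    {ι : Type*} [Fintype ι] (x : ι → X) (α : ι → ℝ) (hα : ∑ i, α i = 0) :
    ∑ i, ∑ j, α i * α j * ∫ s, (φ (x i) s - φ (x j) s) ^ 2 ∂ρ ≤ 0 := by
  have hint : ∀ i j, Integrable (fun s => α i * α j * (φ (x i) s - φ (x j) s) ^ 2) ρ :=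
    fun i j => (hφ _ _).const_mul _
  have hsum : ∑ i, ∑ j, α i * α j * ∫ s, (φ (x i) s - φ (x j) s) ^ 2 ∂ρ =
      ∫ s, ∑ i, ∑ j, α i * α j * (φ (x i) s - φ (x j) s) ^ 2 ∂ρ := by
    rw [integral_finsetSum _ fun i _ => integrable_finsetSum _ fun j _ => hint i j]
    refine Finset.sum_congr rfl fun i _ => ?_
    rw [integral_finsetSum _ fun j _ => hint i j]
    simp only [integral_const_mul]
  rw [hsum]
  refine integral_nonpos fun s => ?_
  have : ∑ i, ∑ j, α i * α j * (φ (x i) s - φ (x j) s) ^ 2 =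
      2 * ((∑ i, α i) * ∑ i, α i * φ (x i) s ^ 2) - 2 * (∑ i, α i * φ (x i) s) ^ 2 := by
    have h1 : (∑ i, α i) * ∑ j, α j * φ (x j) s ^ 2 =
      ∑ i, ∑ j, α i * (α j * φ (x j) s ^ 2) := Finset.sum_mul_sum ..
    have h2 : (∑ i, α i * φ (x i) s ^ 2) * ∑ j, α j =
      ∑ i, ∑ j, α i * φ (x i) s ^ 2 * α j := Finset.sum_mul_sum ..
    have h3 : (∑ i, α i * φ (x i) s) * ∑ j, α j * φ (x j) s =
      ∑ i, ∑ j, α i * φ (x i) s * (α j * φ (x j) s) := Finset.sum_mul_sum ..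
    rw [sq, h3, two_mul, h1]
    nth_rewrite 2 [← h1]
    rw [mul_comm (∑ i, α i), h2]
    simp only [Finset.mul_sum, ← Finset.sum_add_distrib, ← Finset.sum_sub_distrib]
    refine Finset.sum_congr rfl fun i _ => Finset.sum_congr rfl fun j _ => ?_
    ring
  change _ ≤ 0
  rw [this, hα]
  nlinarith [sq_nonneg (∑ i, α i * φ (x i) s)]

variable [MeasurableSpace X] [SFinite ρ]

/-- Fubini's theorem for the kernel `∫ (φ x s - φ y s)² dρ(s)`. -/
theorem integral_integral_integral_sq_sub (hφ : Measurable (Function.uncurry φ))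
    (hb : ∀ x s, |φ x s| ≤ 1) (hi : ∀ x y, Integrable (fun s => (φ x s - φ y s) ^ 2) ρ)
    (μ ν : Measure X) [IsProbabilityMeasure μ] [IsProbabilityMeasure ν]
    (hk : Integrable (fun q : X × X => ∫ s, (φ q.1 s - φ q.2 s) ^ 2 ∂ρ) (μ.prod ν)) :
    Integrable (fun s => (∫ x, φ x s ^ 2 ∂μ) + (∫ x, φ x s ^ 2 ∂ν)
      - 2 * ((∫ x, φ x s ∂μ) * ∫ x, φ x s ∂ν)) ρ ∧
    ∫ x, ∫ y, ∫ s, (φ x s - φ y s) ^ 2 ∂ρ ∂ν ∂μ =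
      ∫ s, ((∫ x, φ x s ^ 2 ∂μ) + (∫ x, φ x s ^ 2 ∂ν)
        - 2 * ((∫ x, φ x s ∂μ) * ∫ x, φ x s ∂ν)) ∂ρ := by
  have hφs : ∀ s, Measurable fun x => φ x s := fun s =>
    hφ.comp (measurable_id.prodMk measurable_const)
  have hm : Measurable fun q : (X × X) × S => (φ q.1.1 q.2 - φ q.1.2 q.2) ^ 2 := by
    have h1 : Measurable fun q : (X × X) × S => φ q.1.1 q.2 :=
      hφ.comp ((measurable_fst.comp measurable_fst).prodMk measurable_snd)
    have h2 : Measurable fun q : (X × X) × S => φ q.1.2 q.2 :=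
      hφ.comp ((measurable_snd.comp measurable_fst).prodMk measurable_snd)
    exact (h1.sub h2).pow_const 2
  have hint : Integrable (fun q : (X × X) × S => (φ q.1.1 q.2 - φ q.1.2 q.2) ^ 2)
      ((μ.prod ν).prod ρ) := by
    rw [integrable_prod_iff hm.aestronglyMeasurable]
    refine ⟨Eventually.of_forall fun q => hi q.1 q.2, ?_⟩
    simpa using hk
  have hφi : ∀ (τ : Measure X) [IsProbabilityMeasure τ] (s : S), Integrable (fun x => φ x s) τ :=
    fun τ _ s => .of_bound (hφs s).aestronglyMeasurable 1 (Eventually.of_forall fun x => hb x s)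
  have hφi2 : ∀ (τ : Measure X) [IsProbabilityMeasure τ] (s : S),
      Integrable (fun x => φ x s ^ 2) τ :=
    fun τ _ s => .of_bound ((hφs s).pow_const 2).aestronglyMeasurable 1
      (Eventually.of_forall fun x => by simpa using hb x s)
  have hinner : ∀ s, ∫ q, (φ q.1 s - φ q.2 s) ^ 2 ∂(μ.prod ν) = (∫ x, φ x s ^ 2 ∂μ) +
      (∫ x, φ x s ^ 2 ∂ν) - 2 * ((∫ x, φ x s ∂μ) * ∫ x, φ x s ∂ν) := by
    intro s
    have h1 : Integrable (fun q : X × X => φ q.1 s ^ 2) (μ.prod ν) := (hφi2 μ s).comp_fst ν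
    have h2 : Integrable (fun q : X × X => φ q.2 s ^ 2) (μ.prod ν) := (hφi2 ν s).comp_snd μ
    have h3 : Integrable (fun q : X × X => φ q.1 s * φ q.2 s) (μ.prod ν) :=
      (hφi μ s).mul_prod (hφi ν s)
    have h4 : ∀ q : X × X, (φ q.1 s - φ q.2 s) ^ 2 =
        φ q.1 s ^ 2 + φ q.2 s ^ 2 - 2 * (φ q.1 s * φ q.2 s) := fun q => by ring
    simp only [h4]
    rw [integral_add_sub_two_mul h1 h2 h3,
      integral_prod_mul (fun x => φ x s) (fun x => φ x s),
      integral_fun_fst (fun x => φ x s ^ 2), integral_fun_snd (fun x => φ x s ^ 2)]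
    simp
  have hr := hint.integral_prod_right
  simp only [hinner] at hr
  refine ⟨hr, ?_⟩
  rw [← integral_prod (fun q : X × X => ∫ s, (φ q.1 s - φ q.2 s) ^ 2 ∂ρ) hk,
    integral_integral_swap hint]
  simp only [hinner]

/-- If `k x y = ∫ (φ x s - φ y s)² dρ(s)`, then the integral of `k` against `(μ - ν)²` is
`-2 ∫ (∫ φ x s d(μ - ν)(x))² dρ(s)`. -/
theorem integral_integral_integral_sq_sub_energy (hφ : Measurable (Function.uncurry φ))
    (hb : ∀ x s, |φ x s| ≤ 1) (hi : ∀ x y, Integrable (fun s => (φ x s - φ y s) ^ 2) ρ)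
    (μ ν : Measure X) [IsProbabilityMeasure μ] [IsProbabilityMeasure ν]
    (hμμ : Integrable (fun q : X × X => ∫ s, (φ q.1 s - φ q.2 s) ^ 2 ∂ρ) (μ.prod μ))
    (hνν : Integrable (fun q : X × X => ∫ s, (φ q.1 s - φ q.2 s) ^ 2 ∂ρ) (ν.prod ν))
    (hμν : Integrable (fun q : X × X => ∫ s, (φ q.1 s - φ q.2 s) ^ 2 ∂ρ) (μ.prod ν)) :
    Integrable (fun s => ((∫ x, φ x s ∂μ) - ∫ x, φ x s ∂ν) ^ 2) ρ ∧
    (∫ x, ∫ y, ∫ s, (φ x s - φ y s) ^ 2 ∂ρ ∂μ ∂μ) + (∫ x, ∫ y, ∫ s, (φ x s - φ y s) ^ 2 ∂ρ ∂ν ∂ν)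
      - 2 * ∫ x, ∫ y, ∫ s, (φ x s - φ y s) ^ 2 ∂ρ ∂ν ∂μ =
      -2 * ∫ s, ((∫ x, φ x s ∂μ) - ∫ x, φ x s ∂ν) ^ 2 ∂ρ := by
  obtain ⟨i1, e1⟩ := integral_integral_integral_sq_sub hφ hb hi μ μ hμμ
  obtain ⟨i2, e2⟩ := integral_integral_integral_sq_sub hφ hb hi ν ν hνν
  obtain ⟨i3, e3⟩ := integral_integral_integral_sq_sub hφ hb hi μ ν hμν
  have hsq : ∀ s, ((∫ x, φ x s ∂μ) - ∫ x, φ x s ∂ν) ^ 2 = (-1 / 2) *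
      (((∫ x, φ x s ^ 2 ∂μ) + (∫ x, φ x s ^ 2 ∂μ) - 2 * ((∫ x, φ x s ∂μ) * ∫ x, φ x s ∂μ)) +
      ((∫ x, φ x s ^ 2 ∂ν) + (∫ x, φ x s ^ 2 ∂ν) - 2 * ((∫ x, φ x s ∂ν) * ∫ x, φ x s ∂ν)) -
      2 * ((∫ x, φ x s ^ 2 ∂μ) + (∫ x, φ x s ^ 2 ∂ν)
        - 2 * ((∫ x, φ x s ∂μ) * ∫ x, φ x s ∂ν))) := fun s => by ring
  simp only [hsq]
  refine ⟨((i1.add i2).sub (i3.const_mul 2)).const_mul _, ?_⟩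
  rw [integral_const_mul, integral_add_sub_two_mul i1 i2 i3, e1, e2, e3]
  ring

/-- A probability measure on the line is determined by its values on almost all the half-lines
`[s, ∞)`. -/
theorem Measure.ext_of_ae_Ici {μ ν : Measure ℝ} [IsProbabilityMeasure μ] [IsProbabilityMeasure ν]
    (h : ∀ᵐ s : ℝ, μ (Ici s) = ν (Ici s)) : μ = ν := by
  have hd : Dense {s : ℝ | μ (Ici s) = ν (Ici s)} := Measure.dense_of_ae h
  refine ext_of_generate_finite _
    ((BorelSpace.measurable_eq (α := ℝ)).trans hd.borel_eq_generateFrom_Ico_mem)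
    (isPiSystem_Ico_mem _ _) ?_ (by simp)
  rintro _ ⟨l, hl, u, hu, hlu, rfl⟩
  have hsub : Ici u ⊆ Ici l := Ici_subset_Ici.2 hlu.le
  rw [← Ici_sdiff_Ici, measure_sdiff hsub measurableSet_Ici.nullMeasurableSet (by finiteness),
    measure_sdiff hsub measurableSet_Ici.nullMeasurableSet (by finiteness), hl, hu]

end MeasureTheory

namespace UpperHalfPlane

/-- `arsinh s` differs from `log s` by `log 2` in the limit `s → ∞`. -/
theorem tendsto_arsinh_sub_log :
    Tendsto (fun s : ℝ => Real.arsinh s - Real.log s) atTop (𝓝 (Real.log 2)) := by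
  have h : Tendsto (fun s : ℝ => Real.log (1 + √(1 + (s⁻¹) ^ 2))) atTop (𝓝 (Real.log 2)) := by
    have h1 : Tendsto (fun s : ℝ => 1 + √(1 + (s⁻¹) ^ 2)) atTop (𝓝 (1 + √(1 + 0 ^ 2))) :=
      (((tendsto_inv_atTop_zero.pow 2).const_add 1).sqrt).const_add 1
    have h2 : (1 + √(1 + 0 ^ 2) : ℝ) = 2 := by norm_num
    rw [h2] at h1
    exact h1.log two_ne_zero
  refine h.congr' ?_
  filter_upwards [eventually_gt_atTop 0] with s hs
  have h3 : s + √(1 + s ^ 2) = s * (1 + √(1 + (s⁻¹) ^ 2)) := by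
    have : (1 + s ^ 2 : ℝ) = s ^ 2 * (1 + (s⁻¹) ^ 2) := by field_simp; ring
    rw [this, Real.sqrt_mul (sq_nonneg s), Real.sqrt_sq hs.le]
    ring
  rw [Real.arsinh, h3, Real.log_mul hs.ne' (by positivity)]
  ring

theorem tendsto_arsinh_sub_arsinh {x y u v : ℝ} (hy : 0 < y) (hv : 0 < v) :
    Tendsto (fun c => Real.arsinh ((c - x) / y) - Real.arsinh ((c - u) / v)) atTop
      (𝓝 (Real.log v - Real.log y)) := by
  have key : ∀ {a b : ℝ}, 0 < b →
      Tendsto (fun c => Real.arsinh ((c - a) / b) - Real.log c) atTop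
        (𝓝 (Real.log 2 - Real.log b)) := by
    intro a b hb
    have h1 : Tendsto (fun c : ℝ => (c - a) / b) atTop atTop :=
      (tendsto_atTop_add_const_right _ (-a) tendsto_id).atTop_div_const hb
    have h2 := ((tendsto_arsinh_sub_log.comp h1).add
      (Real.tendsto_log_comp_add_sub_log (-a))).sub_const (Real.log b)
    rw [add_zero] at h2
    refine h2.congr' ?_
    filter_upwards [eventually_gt_atTop a] with c hc
    simp only [Function.comp]
    rw [Real.log_div (sub_pos.2 hc).ne' hb.ne', ← sub_eq_add_neg]
    ring
  have := (key (a := x) hy).sub (key (a := u) hv)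
  convert this using 2 <;> ring

theorem hasDerivAt_arsinh_sub_arsinh {x y u v : ℝ} (hy : 0 < y) (hv : 0 < v) (c : ℝ) :
    HasDerivAt (fun c => Real.arsinh ((c - x) / y) - Real.arsinh ((c - u) / v))
      ((√((c - x) ^ 2 + y ^ 2))⁻¹ - (√((c - u) ^ 2 + v ^ 2))⁻¹) c := by
  have key : ∀ {a b : ℝ}, 0 < b →
      HasDerivAt (fun c => Real.arsinh ((c - a) / b)) (√((c - a) ^ 2 + b ^ 2))⁻¹ c := by
    intro a b hb
    have h := (((hasDerivAt_id c).sub_const a).div_const b).arsinh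
    refine h.congr_deriv ?_
    have : (c - a) ^ 2 + b ^ 2 = b ^ 2 * (1 + ((c - a) / b) ^ 2) := by field_simp; ring
    rw [this, Real.sqrt_mul (sq_nonneg b), Real.sqrt_sq hb.le]
    simp [mul_comm]
  exact (key hy).sub (key hv)

/-- The integral of `|1 / |z - c| - 1 / |w - c||`, for `z = x + iy` and `w = u + iv`, over a
half-line on which `|w - c| ≤ |z - c|`. -/
theorem integral_Ioi_abs_inv_sub_inv {x y u v a : ℝ} (hy : 0 < y) (hv : 0 < v)
    (h : ∀ c ∈ Ioi a, (c - u) ^ 2 + v ^ 2 ≤ (c - x) ^ 2 + y ^ 2) :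
    IntegrableOn (fun c => |(√((c - x) ^ 2 + y ^ 2))⁻¹ - (√((c - u) ^ 2 + v ^ 2))⁻¹|) (Ioi a) ∧
    ∫ c in Ioi a, |(√((c - x) ^ 2 + y ^ 2))⁻¹ - (√((c - u) ^ 2 + v ^ 2))⁻¹| =
      Real.arsinh ((a - x) / y) - Real.arsinh ((a - u) / v) - (Real.log v - Real.log y) := by
  have hneg : ∀ c ∈ Ioi a, (√((c - x) ^ 2 + y ^ 2))⁻¹ - (√((c - u) ^ 2 + v ^ 2))⁻¹ ≤ 0 := by
    intro c hc
    have := h c hc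
    rw [sub_nonpos]
    gcongr
  have hint := integrableOn_Ioi_deriv_of_nonpos'
    (fun c _ => hasDerivAt_arsinh_sub_arsinh hy hv c) hneg (tendsto_arsinh_sub_arsinh hy hv)
  refine ⟨hint.abs, ?_⟩
  rw [setIntegral_congr_fun measurableSet_Ioi (fun c hc => abs_of_nonpos (hneg c hc)),
    integral_neg, integral_Ioi_of_hasDerivAt_of_nonpos'
      (fun c _ => hasDerivAt_arsinh_sub_arsinh hy hv c) hneg (tendsto_arsinh_sub_arsinh hy hv)]
  ring

theorem integral_Iic_abs_inv_sub_inv {x y u v a : ℝ} (hy : 0 < y) (hv : 0 < v)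
    (h : ∀ c ∈ Iio a, (c - u) ^ 2 + v ^ 2 ≤ (c - x) ^ 2 + y ^ 2) :
    IntegrableOn (fun c => |(√((c - x) ^ 2 + y ^ 2))⁻¹ - (√((c - u) ^ 2 + v ^ 2))⁻¹|) (Iic a) ∧
    ∫ c in Iic a, |(√((c - x) ^ 2 + y ^ 2))⁻¹ - (√((c - u) ^ 2 + v ^ 2))⁻¹| =
      Real.arsinh ((a - u) / v) - Real.arsinh ((a - x) / y) - (Real.log v - Real.log y) := by
  have hsq : ∀ c b : ℝ, (-c - b) ^ 2 = (c - -b) ^ 2 := fun c b => by ring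
  have hdiv : ∀ b d : ℝ, (-a - -b) / d = -((a - b) / d) := fun b d => by ring
  obtain ⟨h1, h2⟩ := integral_Ioi_abs_inv_sub_inv (x := -x) (u := -u) (a := -a) hy hv
    (fun c hc => by
      have := h (-c) (by simp only [mem_Ioi, mem_Iio] at *; linarith)
      rwa [hsq, hsq] at this)
  rw [hdiv, hdiv, Real.arsinh_neg, Real.arsinh_neg] at h2
  simp only [← hsq] at h1 h2
  constructor
  · have h3 := (integrableOn_Ici_iff_integrableOn_Ioi (by finiteness)).2 h1
    simpa only [neg_neg] using h3.comp_neg_Iic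
  · rw [← neg_neg a, ← integral_comp_neg_Ioi, h2, neg_neg]
    ring

/-- The Crofton formula in the upper half-plane: `2 d(z, w)` is the invariant measure of the set of
geodesics, that is half-circles centered at real points `c`, that separate `z` from `w`. -/
theorem integral_abs_inv_dist_sub_inv_dist (z w : UpperHalfPlane) :
    Integrable (fun c : ℝ => |(dist (z : ℂ) c)⁻¹ - (dist (w : ℂ) c)⁻¹|) ∧
    ∫ c : ℝ, |(dist (z : ℂ) c)⁻¹ - (dist (w : ℂ) c)⁻¹| = 2 * dist z w := by
  have hd : ∀ (z : UpperHalfPlane) (c : ℝ), dist (z : ℂ) c = √((c - z.re) ^ 2 + z.im ^ 2) := by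
    intro z c
    rw [Complex.dist_eq_re_im]
    simp only [coe_re, coe_im, Complex.ofReal_re, Complex.ofReal_im, sub_zero]
    congr 2; ring
  have split : ∀ {f : ℝ → ℝ} (a : ℝ) {I J : ℝ}, (IntegrableOn f (Iic a) ∧ ∫ c in Iic a, f c = I) →
      (IntegrableOn f (Ioi a) ∧ ∫ c in Ioi a, f c = J) → Integrable f ∧ ∫ c, f c = I + J := by
    rintro f a _ _ ⟨h1, rfl⟩ ⟨h2, rfl⟩
    exact ⟨by simpa [integrableOn_univ] using h1.union h2,
      (intervalIntegral.integral_Iic_add_Ioi h1 h2).symm⟩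
  simp only [hd]
  rcases eq_or_ne z.re w.re with hre | hre
  · wlog him : w.im ≤ z.im generalizing z w
    · rw [dist_comm]
      simp only [abs_sub_comm (√((_ - z.re) ^ 2 + z.im ^ 2))⁻¹]
      exact this w z hre.symm (not_le.1 him).le
    have hle : ∀ c : ℝ, (c - w.re) ^ 2 + w.im ^ 2 ≤ (c - z.re) ^ 2 + z.im ^ 2 := by
      intro c
      rw [hre]
      have := w.im_pos
      gcongr
    obtain ⟨h1, h2⟩ := split z.re (integral_Iic_abs_inv_sub_inv z.im_pos w.im_pos fun c _ => hle c)
      (integral_Ioi_abs_inv_sub_inv z.im_pos w.im_pos fun c _ => hle c)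
    refine ⟨h1, h2.trans ?_⟩
    rw [dist_of_re_eq hre, Real.dist_eq,
      abs_of_nonneg (sub_nonneg.2 (Real.log_le_log w.im_pos him)), hre]
    simp; ring
  · wlog hlt : z.re < w.re generalizing z w
    · rw [dist_comm]
      simp only [abs_sub_comm (√((_ - z.re) ^ 2 + z.im ^ 2))⁻¹]
      exact this w z hre.symm (lt_of_le_of_ne (not_lt.1 hlt) hre.symm)
    have hpos := sub_pos.2 hlt
    obtain ⟨a, ha⟩ : ∃ a : ℝ,
        2 * a * (w.re - z.re) = w.re ^ 2 + w.im ^ 2 - z.re ^ 2 - z.im ^ 2 :=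
      ⟨(w.re ^ 2 + w.im ^ 2 - z.re ^ 2 - z.im ^ 2) / (2 * (w.re - z.re)), by field_simp⟩
    have hr : ∀ c : ℝ, (c - z.re) ^ 2 + z.im ^ 2 - ((c - w.re) ^ 2 + w.im ^ 2) =
        2 * (c - a) * (w.re - z.re) := by
      intro c; linear_combination ha
    have hl := integral_Iic_abs_inv_sub_inv (a := a) w.im_pos z.im_pos (x := w.re) (u := z.re)
      fun c hc => by
        have := mul_pos (sub_pos.2 (mem_Iio.1 hc)) hpos
        linarith [hr c]
    simp only [abs_sub_comm (√((_ - w.re) ^ 2 + w.im ^ 2))⁻¹] at hl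
    have hg := integral_Ioi_abs_inv_sub_inv (a := a) z.im_pos w.im_pos (x := z.re) (u := w.re)
      fun c hc => by
        have := mul_pos (sub_pos.2 (mem_Ioi.1 hc)) hpos
        linarith [hr c]
    obtain ⟨h1, h2⟩ := split a hl hg
    refine ⟨h1, h2.trans ?_⟩
    have hnn : 0 ≤ ∫ c : ℝ, |(√((c - z.re) ^ 2 + z.im ^ 2))⁻¹ - (√((c - w.re) ^ 2 + w.im ^ 2))⁻¹| :=
      integral_nonneg fun _ => abs_nonneg _
    rw [h2] at hnn
    have hcosh : Real.cosh (Real.arsinh ((a - z.re) / z.im) - Real.arsinh ((a - w.re) / w.im)) =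
        Real.cosh (dist z w) := by
      have hzp := z.im_pos
      have hwp := w.im_pos
      have hs : ∀ {b d : ℝ}, 0 < d → √(1 + (b / d) ^ 2) = √(b ^ 2 + d ^ 2) / d := by
        intro b d hd
        have : 1 + (b / d) ^ 2 = (b ^ 2 + d ^ 2) / d ^ 2 := by field_simp; ring
        rw [this, Real.sqrt_div' _ (sq_nonneg d), Real.sqrt_sq hd.le]
      have heq : (a - w.re) ^ 2 + w.im ^ 2 = (a - z.re) ^ 2 + z.im ^ 2 := by
        linarith [hr a, show 2 * (a - a) * (w.re - z.re) = 0 by ring]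
      rw [Real.cosh_sub, Real.cosh_arsinh, Real.cosh_arsinh, Real.sinh_arsinh, Real.sinh_arsinh,
        cosh_dist', hs hzp, hs hwp, heq, div_mul_div_comm, Real.mul_self_sqrt (by positivity)]
      field_simp
      linear_combination -heq
    have hG : dist z w = Real.arsinh ((a - z.re) / z.im) - Real.arsinh ((a - w.re) / w.im) := by
      have := congrArg Real.arcosh hcosh
      rwa [Real.arcosh_cosh (by linarith), Real.arcosh_cosh dist_nonneg, eq_comm] at this
    rw [hG]; ring

/-- A probability measure on the upper half-plane is determined by the laws of the distances to
almost all the real points. The point `z` is encoded as `|z|² + i re z`, so that `|z - c|²` is an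
affine function of the code and the claim becomes one about characteristic functions. -/
theorem ext_of_ae_map_dist (μ ν : Measure UpperHalfPlane) [IsProbabilityMeasure μ]
    [IsProbabilityMeasure ν]
    (h : ∀ᵐ c : ℝ, μ.map (fun z : UpperHalfPlane => (dist (z : ℂ) c)⁻¹) =
      ν.map (fun z : UpperHalfPlane => (dist (z : ℂ) c)⁻¹)) : μ = ν := by
  let q : UpperHalfPlane → ℂ := fun z => ⟨z.re ^ 2 + z.im ^ 2, z.re⟩
  have hqc : Continuous q := by
    have : q = fun z : UpperHalfPlane =>
        ((z.re ^ 2 + z.im ^ 2 : ℝ) : ℂ) + (z.re : ℂ) * Complex.I := by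
      ext z
      exact Complex.mk_eq_add_mul_I _ _
    rw [this]
    have := continuous_re
    have := continuous_im
    fun_prop
  have hqi : Function.Injective q := by
    intro z w hzw
    have h2 : z.re = w.re := congrArg Complex.im hzw
    have h1 : z.re ^ 2 + z.im ^ 2 = w.re ^ 2 + w.im ^ 2 := congrArg Complex.re hzw
    have h3 : z.im = w.im := by
      rw [h2] at h1
      exact (pow_left_inj₀ z.im_pos.le w.im_pos.le two_ne_zero).1 (by linarith)
    exact UpperHalfPlane.ext (Complex.ext h2 h3)
  have hqe : MeasurableEmbedding q := hqc.measurableEmbedding hqi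
  have hprob : ∀ τ : Measure UpperHalfPlane, IsProbabilityMeasure τ →
      IsProbabilityMeasure (τ.map q) := fun τ _ => Measure.isProbabilityMeasure_map hqc.aemeasurable
  have := hprob μ inferInstance
  have := hprob ν inferInstance
  have hchar : ∀ (τ : Measure UpperHalfPlane) (c t : ℝ), charFun (τ.map q) ⟨t, -2 * c * t⟩ =
      Complex.exp (-(c ^ 2 * t : ℝ) * Complex.I) *
        ∫ r, Complex.exp (((r⁻¹) ^ 2 * t : ℝ) * Complex.I)
          ∂(τ.map fun z : UpperHalfPlane => (dist (z : ℂ) c)⁻¹) := by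
    intro τ c t
    have hmeas : Measurable fun z : UpperHalfPlane => (dist (z : ℂ) c)⁻¹ :=
      ((continuous_coe.dist continuous_const).measurable).inv
    rw [charFun_apply, hqe.integral_map, integral_map hmeas.aemeasurable
      (by fun_prop), ← integral_const_mul]
    congr 1 with z
    rw [← Complex.exp_add, inv_inv, Complex.dist_eq_re_im, Real.sq_sqrt (by positivity)]
    congr 1
    rw [← add_mul]
    congr 1
    rw [← Complex.ofReal_neg, ← Complex.ofReal_add]
    congr 1
    simp [q, Complex.inner]
    ring
  have hline : ∀ c t : ℝ, charFun (μ.map q) ⟨t, -2 * c * t⟩ =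
      charFun (ν.map q) ⟨t, -2 * c * t⟩ := by
    intro c t
    have hcont : Continuous fun c : ℝ => (⟨t, -2 * c * t⟩ : ℂ) := by
      simp only [Complex.mk_eq_add_mul_I]
      fun_prop
    have hae : (fun c : ℝ => charFun (μ.map q) ⟨t, -2 * c * t⟩) =ᵐ[volume]
        fun c : ℝ => charFun (ν.map q) ⟨t, -2 * c * t⟩ := by
      filter_upwards [h] with c hc
      rw [hchar, hchar, hc]
    exact congrFun ((Continuous.ae_eq_iff_eq volume (continuous_charFun.comp hcont)
      (continuous_charFun.comp hcont)).1 hae) c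
  have hmap : μ.map q = ν.map q := by
    refine Measure.ext_of_charFun ?_
    refine Continuous.ext_on (s := {w : ℂ | w.re ≠ 0}) ?_ continuous_charFun continuous_charFun ?_
    · exact (dense_compl_singleton (0 : ℝ)).preimage Complex.isOpenMap_re
    · intro w hw
      have : w = ⟨w.re, -2 * (-w.im / (2 * w.re)) * w.re⟩ := by
        have : w.re ≠ 0 := hw
        apply Complex.ext
        · rfl
        · simp only; field_simp
      rw [this]
      exact hline _ _
  rw [← hqe.comap_map μ, hmap, hqe.comap_map]


/-- The indicator function of the set of half-disks centered on the real line that contain `z`;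
the pair `(c, s)` stands for the closed half-disk with center `c` and radius `s⁻¹`. -/
noncomputable def chi (z : UpperHalfPlane) (p : ℝ × ℝ) : ℝ :=
  (Iic (dist (z : ℂ) p.1)⁻¹).indicator 1 p.2

theorem measurable_chi : Measurable (Function.uncurry chi) := by
  have h : Measurable fun q : UpperHalfPlane × (ℝ × ℝ) => (dist (q.1 : ℂ) (q.2.1 : ℂ))⁻¹ :=
    (((continuous_coe.comp continuous_fst).dist
      (Complex.continuous_ofReal.comp (continuous_fst.comp continuous_snd))).measurable).inv
  have hs : MeasurableSet {q : UpperHalfPlane × (ℝ × ℝ) |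
      q.2.2 ≤ (dist (q.1 : ℂ) (q.2.1 : ℂ))⁻¹} :=
    measurableSet_le (measurable_snd.comp measurable_snd) h
  exact (measurable_one (α := ℝ)).indicator hs

theorem abs_chi_le_one (z : UpperHalfPlane) (p : ℝ × ℝ) : |chi z p| ≤ 1 := by
  unfold chi
  by_cases h : p.2 ∈ Iic (dist (z : ℂ) p.1)⁻¹ <;> simp [h]

theorem sq_indicator_Iic_sub_indicator_Iic (a b s : ℝ) :
    ((Iic a).indicator (1 : ℝ → ℝ) s - (Iic b).indicator (1 : ℝ → ℝ) s) ^ 2 =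
      (uIoc a b).indicator 1 s := by
  by_cases h1 : s ≤ a <;> by_cases h2 : s ≤ b <;>
    simp [indicator, mem_uIoc, h1, h2, not_lt.2, not_le.1]

/-- The Crofton formula in terms of half-disks. -/
theorem integral_sq_chi_sub_chi (z w : UpperHalfPlane) :
    Integrable (fun p => (chi z p - chi w p) ^ 2) ∧
    ∫ p, (chi z p - chi w p) ^ 2 = 2 * dist z w := by
  obtain ⟨h1, h2⟩ := integral_abs_inv_dist_sub_inv_dist z w
  have hchi : ∀ z : UpperHalfPlane, Measurable (chi z) := fun z => measurable_chi.of_uncurry_left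
  have hsec : ∀ c : ℝ, (fun s => (chi z (c, s) - chi w (c, s)) ^ 2) =
      (uIoc (dist (z : ℂ) c)⁻¹ (dist (w : ℂ) c)⁻¹).indicator (1 : ℝ → ℝ) := fun c =>
    funext fun s => sq_indicator_Iic_sub_indicator_Iic _ _ s
  have hsec_integral : ∀ c : ℝ, ∫ s, (chi z (c, s) - chi w (c, s)) ^ 2 =
      |(dist (z : ℂ) c)⁻¹ - (dist (w : ℂ) c)⁻¹| := by
    intro c
    rw [hsec, integral_indicator_one measurableSet_uIoc, measureReal_def, Real.volume_uIoc,
      abs_sub_comm, ENNReal.toReal_ofReal (abs_nonneg _)]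
  have hint : Integrable (fun p => (chi z p - chi w p) ^ 2)
      ((volume : Measure ℝ).prod (volume : Measure ℝ)) := by
    have hmeas : Measurable fun p => (chi z p - chi w p) ^ 2 :=
      ((hchi z).sub (hchi w)).pow_const 2
    rw [integrable_prod_iff hmeas.aestronglyMeasurable]
    constructor
    · refine Eventually.of_forall fun c => ?_
      rw [hsec, integrable_indicator_iff measurableSet_uIoc]
      exact integrableOn_const (C := (1 : ℝ)) (by simp [Real.volume_uIoc])
    · simpa only [norm_pow, Real.norm_eq_abs, sq_abs, hsec_integral] using h1
  refine ⟨hint, ?_⟩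
  rw [Measure.volume_eq_prod, integral_prod _ hint]
  simp only [hsec_integral, h2]

theorem integrable_dist_prod {μ ν : Measure UpperHalfPlane} [IsProbabilityMeasure μ]
    [IsProbabilityMeasure ν] (hμ : ∃ o, Integrable (fun x => dist o x) μ)
    (hν : ∃ o, Integrable (fun x => dist o x) ν) :
    Integrable (fun q : UpperHalfPlane × UpperHalfPlane => dist q.1 q.2) (μ.prod ν) := by
  obtain ⟨o, ho⟩ := hμ
  obtain ⟨o₂, ho₂⟩ := hν
  refine (((ho.comp_fst ν).add (integrable_const (dist o o₂))).add (ho₂.comp_snd μ)).mono'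
    continuous_dist.aestronglyMeasurable (Eventually.of_forall fun q => ?_)
  rw [Real.norm_of_nonneg dist_nonneg]
  calc dist q.1 q.2 ≤ dist q.1 o + dist o o₂ + dist o₂ q.2 := dist_triangle4 _ _ _ _
    _ = _ := by simp [dist_comm q.1 o]

theorem ext_of_ae_integral_chi (μ ν : Measure UpperHalfPlane) [IsProbabilityMeasure μ]
    [IsProbabilityMeasure ν] (h : ∀ᵐ p : ℝ × ℝ, ∫ z, chi z p ∂μ = ∫ z, chi z p ∂ν) : μ = ν := by
  rw [Measure.volume_eq_prod] at h
  refine ext_of_ae_map_dist μ ν ?_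
  filter_upwards [Measure.ae_ae_of_ae_prod h] with c hc
  have hmeas : Measurable fun z : UpperHalfPlane => (dist (z : ℂ) c)⁻¹ :=
    ((continuous_coe.dist continuous_const).measurable).inv
  have hprob : ∀ τ : Measure UpperHalfPlane, IsProbabilityMeasure τ →
      IsProbabilityMeasure (τ.map fun z : UpperHalfPlane => (dist (z : ℂ) c)⁻¹) :=
    fun τ _ => Measure.isProbabilityMeasure_map hmeas.aemeasurable
  have := hprob μ inferInstance
  have := hprob ν inferInstance
  refine Measure.ext_of_ae_Ici ?_
  filter_upwards [hc] with s hs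
  have hchi : ∀ τ : Measure UpperHalfPlane, ∫ z, chi z (c, s) ∂τ =
      τ.real ((fun z : UpperHalfPlane => (dist (z : ℂ) c)⁻¹) ⁻¹' Ici s) := fun τ =>
    integral_indicator_one (hmeas measurableSet_Ici)
  rw [hchi, hchi] at hs
  rw [Measure.map_apply hmeas measurableSet_Ici, Measure.map_apply hmeas measurableSet_Ici]
  exact (measureReal_eq_measureReal_iff (by finiteness) (by finiteness)).1 hs

end UpperHalfPlane

open UpperHalfPlane in
/-- The real hyperbolic plane (the upper half-plane with its hyperbolic metric)
has strong negative type: it has negative type, and for all Borel probability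
measures `μ₁, μ₂` with finite first moment, the integral of the distance against
`(μ₁ - μ₂)²` is nonpositive, with equality only when `μ₁ = μ₂`. -/
theorem upperHalfPlane_strongNegativeType :
    (∀ (n : ℕ), 1 ≤ n → ∀ (x : Fin n → UpperHalfPlane) (α : Fin n → ℝ),
      ∑ i, α i = 0 → ∑ i, ∑ j, α i * α j * dist (x i) (x j) ≤ 0) ∧
    (∀ (μ₁ μ₂ : Measure UpperHalfPlane), IsProbabilityMeasure μ₁ →
      IsProbabilityMeasure μ₂ →
      (∃ o, Integrable (fun x => dist o x) μ₁) →
      (∃ o, Integrable (fun x => dist o x) μ₂) →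
      (∫ x, ∫ y, dist x y ∂μ₁ ∂μ₁) + (∫ x, ∫ y, dist x y ∂μ₂ ∂μ₂)
          - 2 * ∫ x, ∫ y, dist x y ∂μ₂ ∂μ₁ ≤ 0 ∧
      ((∫ x, ∫ y, dist x y ∂μ₁ ∂μ₁) + (∫ x, ∫ y, dist x y ∂μ₂ ∂μ₂)
          - 2 * ∫ x, ∫ y, dist x y ∂μ₂ ∂μ₁ = 0 → μ₁ = μ₂)) := by
  have hi : ∀ z w, Integrable (fun p => (chi z p - chi w p) ^ 2) := fun z w =>
    (integral_sq_chi_sub_chi z w).1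
  have he : ∀ z w, ∫ p, (chi z p - chi w p) ^ 2 = 2 * dist z w := fun z w =>
    (integral_sq_chi_sub_chi z w).2
  refine ⟨fun n _ x α hα => ?_, fun μ₁ μ₂ _ _ h₁ h₂ => ?_⟩
  · have h := sum_mul_integral_sq_sub_nonpos hi x α hα
    simp only [he, mul_left_comm _ (2 : ℝ), ← Finset.mul_sum] at h
    linarith
  · have hk : ∀ {μ ν : Measure UpperHalfPlane} [IsProbabilityMeasure μ] [IsProbabilityMeasure ν],
        (∃ o, Integrable (fun x => dist o x) μ) → (∃ o, Integrable (fun x => dist o x) ν) →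
        Integrable (fun q : UpperHalfPlane × UpperHalfPlane =>
          ∫ p, (chi q.1 p - chi q.2 p) ^ 2) (μ.prod ν) := fun hμ hν => by
      simpa only [he] using (integrable_dist_prod hμ hν).const_mul 2
    obtain ⟨hint, h⟩ := integral_integral_integral_sq_sub_energy measurable_chi abs_chi_le_one hi
      μ₁ μ₂ (hk h₁ h₁) (hk h₂ h₂) (hk h₁ h₂)
    simp only [he, integral_const_mul] at h
    have hnn : 0 ≤ ∫ p, ((∫ z, chi z p ∂μ₁) - ∫ z, chi z p ∂μ₂) ^ 2 :=
      integral_nonneg fun _ => sq_nonneg _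
    refine ⟨by linarith, fun h0 => ext_of_ae_integral_chi μ₁ μ₂ ?_⟩
    have hz : ∫ p, ((∫ z, chi z p ∂μ₁) - ∫ z, chi z p ∂μ₂) ^ 2 = 0 := by linarith
    filter_upwards [(integral_eq_zero_iff_of_nonneg (fun _ => sq_nonneg _) hint).1 hz] with p hp
    exact sub_eq_zero.1 (pow_eq_zero_iff two_ne_zero |>.1 hp)
end

section
/- The real hyperbolic plane (Mathlib's `UpperHalfPlane` with its hyperbolic metric) has negative type: for all n ≥ 1, all points x₁,…,xₙ in the hyperbolic plane, and all reals α₁,…,αₙ with Σᵢ αᵢ = 0, one has Σᵢⱼ αᵢαⱼ d(xᵢ,xⱼ) ≤ 0. -/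
open Filter Topology Matrix

namespace Matrix

variable {ι : Type*} [Fintype ι]

theorem posSemidef_real_iff_sum {M : Matrix ι ι ℝ} :
    M.PosSemidef ↔
      (∀ i j, M i j = M j i) ∧ ∀ v : ι → ℝ, 0 ≤ ∑ i, ∑ j, v i * v j * M i j := by
  have key (v : ι → ℝ) : star v ⬝ᵥ M *ᵥ v = ∑ i, ∑ j, v i * v j * M i j := by
    simp only [dotProduct, mulVec, Finset.mul_sum, Pi.star_apply, star_trivial]
    exact Finset.sum_congr rfl fun i _ => Finset.sum_congr rfl fun j _ => by ring
  rw [posSemidef_iff_dotProduct_mulVec]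
  simp_rw [key]
  simp only [IsHermitian.ext_iff, star_trivial, eq_comm]

/-- Positive semidefiniteness is preserved by entrywise limits. -/
theorem PosSemidef.of_tendsto {F : ℕ → Matrix ι ι ℝ} {M : Matrix ι ι ℝ}
    (hF : ∀ n, (F n).PosSemidef)
    (hM : ∀ i j, Tendsto (fun n => F n i j) atTop (𝓝 (M i j))) : M.PosSemidef := by
  rw [posSemidef_real_iff_sum]
  refine ⟨fun i j => tendsto_nhds_unique (hM i j) ?_, fun v => ?_⟩
  · simpa only [(posSemidef_real_iff_sum.1 (hF _)).1 i j] using hM j i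
  · refine ge_of_tendsto' (x := atTop) ?_ fun n => (posSemidef_real_iff_sum.1 (hF n)).2 v
    exact tendsto_finsetSum _ fun i _ => tendsto_finsetSum _ fun j _ => (hM i j).const_mul _

theorem PosSemidef.of_mul_apply (v : ι → ℝ) : (of fun i j => v i * v j).PosSemidef := by
  simpa [vecMulVec] using posSemidef_vecMulVec_self_star v

theorem PosSemidef.map_pow {M : Matrix ι ι ℝ} (hM : M.PosSemidef) (k : ℕ) :
    (M.map (· ^ k)).PosSemidef := by
  induction k with
  | zero => simpa [Matrix.map] using PosSemidef.of_mul_apply (fun _ : ι => (1 : ℝ))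
  | succ k ih =>
    have h : M.map (· ^ (k + 1)) = (M.map (· ^ k)) ⊙ M := by
      ext i j
      simp [pow_succ]
    exact h ▸ ih.hadamard hM

/-- Applying a power series with nonnegative coefficients entrywise preserves positive
semidefiniteness. -/
theorem PosSemidef.map_of_hasSum {M : Matrix ι ι ℝ} (hM : M.PosSemidef) {c : ℕ → ℝ}
    (hc : ∀ k, 0 ≤ c k) {f : ℝ → ℝ}
    (hf : ∀ i j, HasSum (fun k => c k * M i j ^ k) (f (M i j))) : (M.map f).PosSemidef := by
  refine PosSemidef.of_tendsto (F := fun n => ∑ k ∈ Finset.range n, c k • M.map (· ^ k))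
    (fun n => posSemidef_sum _ fun k _ => (hM.map_pow k).smul (hc k)) fun i j => ?_
  simpa [Matrix.sum_apply] using (hf i j).tendsto_sum_nat

theorem PosSemidef.map_inv_one_sub {M : Matrix ι ι ℝ} (hM : M.PosSemidef)
    (h : ∀ i j, |M i j| < 1) : (M.map fun t => (1 - t)⁻¹).PosSemidef :=
  hM.map_of_hasSum (c := fun _ => 1) (fun _ => zero_le_one) fun i j => by
    simpa using hasSum_geometric_of_abs_lt_one (h i j)

theorem PosSemidef.map_neg_log_one_sub {M : Matrix ι ι ℝ} (hM : M.PosSemidef)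
    (h : ∀ i j, |M i j| < 1) : (M.map fun t => -Real.log (1 - t)).PosSemidef := by
  refine hM.map_of_hasSum (c := fun k => (k : ℝ)⁻¹) (fun k => by positivity) fun i j => ?_
  rw [← hasSum_nat_add_iff' 1]
  simpa [div_eq_inv_mul] using Real.hasSum_pow_div_log_of_abs_lt_one (h i j)

end Matrix

/-- The iteration `g ↦ (p + g ^ 2) / 2` started at `0` converges to its smaller fixed point. -/
theorem tendsto_iterate_one_sub_sqrt {p : ℝ} (hp : 0 ≤ p) (hp' : p ≤ 1) :
    Tendsto (fun n => (fun g : ℝ => (p + g ^ 2) / 2)^[n] 0) atTop (𝓝 (1 - √(1 - p))) := by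
  set g : ℕ → ℝ := fun n => (fun g : ℝ => (p + g ^ 2) / 2)^[n] 0 with hg
  have succ (n : ℕ) : g (n + 1) = (p + g n ^ 2) / 2 := Function.iterate_succ_apply' _ _ _
  have nonneg (n : ℕ) : 0 ≤ g n := by
    cases n with
    | zero => simp [hg]
    | succ n => rw [succ]; positivity
  have le_one (n : ℕ) : g n ≤ 1 := by
    induction n with
    | zero => simp [hg]
    | succ n ih => rw [succ]; nlinarith [nonneg n]
  have mono : Monotone g := monotone_nat_of_le_succ fun n => by
    induction n with
    | zero => simpa [hg] using nonneg 1
    | succ n ih => rw [succ, succ (n + 1)]; nlinarith [nonneg n]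
  obtain ⟨l, hl⟩ : ∃ l, Tendsto g atTop (𝓝 l) :=
    ⟨_, tendsto_atTop_ciSup mono ⟨1, by rintro _ ⟨n, rfl⟩; exact le_one n⟩⟩
  have hfix : l = (p + l ^ 2) / 2 := by
    refine tendsto_nhds_unique (hl.comp (tendsto_add_atTop_nat 1)) ?_
    simpa only [Function.comp_def, succ] using ((hl.pow 2).const_add p).div_const 2
  have hl1 : l ≤ 1 := le_of_tendsto' hl le_one
  have : √(1 - p) = 1 - l := by
    rw [show 1 - p = (1 - l) ^ 2 by linarith, Real.sqrt_sq (by linarith)]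
  rwa [this, sub_sub_cancel]

theorem Matrix.PosSemidef.map_one_sub_sqrt_one_sub {ι : Type*} [Fintype ι] {M : Matrix ι ι ℝ}
    (hM : M.PosSemidef) (h0 : ∀ i j, 0 ≤ M i j) (h1 : ∀ i j, M i j ≤ 1) :
    (M.map fun p => 1 - √(1 - p)).PosSemidef := by
  refine PosSemidef.of_tendsto
    (F := fun n => M.map fun p => (fun g : ℝ => (p + g ^ 2) / 2)^[n] 0) (fun n => ?_)
    fun i j => tendsto_iterate_one_sub_sqrt (h0 i j) (h1 i j)
  induction n with
  | zero => exact PosSemidef.zero (n := ι) (R := ℝ)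
  | succ n ih =>
    convert (hM.add (ih.map_pow 2)).smul (show (0 : ℝ) ≤ 1 / 2 by norm_num) using 1
    ext i j
    simp only [Matrix.map_apply, Matrix.smul_apply, Matrix.add_apply,
      Function.iterate_succ_apply', smul_eq_mul]
    ring

namespace UpperHalfPlane

/-- The time coordinate of a point in the hyperboloid model. -/
noncomputable def hyperboloidTime (z : UpperHalfPlane) : ℝ :=
  (z.re ^ 2 + z.im ^ 2 + 1) / (2 * z.im)

/-- The inner product of two points in the Klein disc model. -/
noncomputable def kleinInner (z w : UpperHalfPlane) : ℝ :=
  2 * z.re / (z.re ^ 2 + z.im ^ 2 + 1) * (2 * w.re / (w.re ^ 2 + w.im ^ 2 + 1)) +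
    (z.re ^ 2 + z.im ^ 2 - 1) / (z.re ^ 2 + z.im ^ 2 + 1) *
      ((w.re ^ 2 + w.im ^ 2 - 1) / (w.re ^ 2 + w.im ^ 2 + 1))

theorem hyperboloidTime_pos (z : UpperHalfPlane) : 0 < hyperboloidTime z := by
  have := z.im_pos
  unfold hyperboloidTime
  positivity

theorem cosh_dist_eq_mul_one_sub_kleinInner (z w : UpperHalfPlane) :
    Real.cosh (dist z w) = hyperboloidTime z * hyperboloidTime w * (1 - kleinInner z w) := by
  have hz := z.im_pos
  have hw := w.im_pos
  have hz' : z.re ^ 2 + z.im ^ 2 + 1 ≠ 0 := by positivity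
  have hw' : w.re ^ 2 + w.im ^ 2 + 1 ≠ 0 := by positivity
  rw [cosh_dist', hyperboloidTime, hyperboloidTime, kleinInner]
  field_simp
  ring

theorem abs_kleinInner_lt_one (z w : UpperHalfPlane) : |kleinInner z w| < 1 := by
  have hz := z.im_pos
  have hw := w.im_pos
  refine abs_lt.2 ⟨?_, ?_⟩
  · have : 1 + kleinInner z w = 2 * ((z.re * w.re + 1) ^ 2 + (z.re * w.im) ^ 2 +
        (z.im * w.re) ^ 2 + (z.im * w.im) ^ 2) /
        ((z.re ^ 2 + z.im ^ 2 + 1) * (w.re ^ 2 + w.im ^ 2 + 1)) := by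
      unfold kleinInner
      field_simp
      ring
    have : 0 < 1 + kleinInner z w := by rw [this]; positivity
    linarith
  · have h := Real.cosh_pos (dist z w)
    rw [cosh_dist_eq_mul_one_sub_kleinInner] at h
    have := pos_of_mul_pos_right h
      (mul_pos (hyperboloidTime_pos z) (hyperboloidTime_pos w)).le
    linarith

theorem dist_eq_log_add_log (z w : UpperHalfPlane) :
    dist z w = Real.log (hyperboloidTime z) + Real.log (hyperboloidTime w) + Real.log 2 +
      Real.log (1 - kleinInner z w) +
      Real.log (1 - (1 / 2) * (1 - √(1 - (Real.cosh (dist z w))⁻¹ ^ 2))) := by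
  have hz := (hyperboloidTime_pos z).ne'
  have hw := (hyperboloidTime_pos w).ne'
  have hK : 1 - kleinInner z w ≠ 0 := by linarith [(abs_lt.1 (abs_kleinInner_lt_one z w)).2]
  have hc := Real.cosh_pos (dist z w)
  have hs : 0 ≤ Real.sinh (dist z w) := Real.sinh_nonneg_iff.2 dist_nonneg
  have hsqrt : √(1 - (Real.cosh (dist z w))⁻¹ ^ 2) =
      Real.sinh (dist z w) / Real.cosh (dist z w) := by
    have h : 1 - (Real.cosh (dist z w))⁻¹ ^ 2 =
        (Real.sinh (dist z w) / Real.cosh (dist z w)) ^ 2 := by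
      rw [div_pow, Real.sinh_sq]
      field_simp
    rw [h, Real.sqrt_sq (div_nonneg hs hc.le)]
  have hpos : 0 < 1 - (1 / 2) * (1 - √(1 - (Real.cosh (dist z w))⁻¹ ^ 2)) := by
    linarith [Real.sqrt_nonneg (1 - (Real.cosh (dist z w))⁻¹ ^ 2)]
  rw [← Real.log_mul hz hw, add_right_comm (Real.log _), ← Real.log_mul (mul_ne_zero hz hw) hK,
    ← cosh_dist_eq_mul_one_sub_kleinInner, ← Real.log_mul hc.ne' two_ne_zero,
    ← Real.log_mul (by positivity) hpos.ne', hsqrt]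
  have : Real.cosh (dist z w) * 2 *
      (1 - 1 / 2 * (1 - Real.sinh (dist z w) / Real.cosh (dist z w))) = Real.exp (dist z w) := by
    rw [← Real.cosh_add_sinh]
    field_simp
    ring
  rw [this, Real.log_exp]

variable {ι : Type*} [Fintype ι] (x : ι → UpperHalfPlane)

theorem posSemidef_kleinInner : (Matrix.of fun i j => kleinInner (x i) (x j)).PosSemidef :=
  (PosSemidef.of_mul_apply fun i => 2 * (x i).re / ((x i).re ^ 2 + (x i).im ^ 2 + 1)).add
    (PosSemidef.of_mul_apply fun i =>
      ((x i).re ^ 2 + (x i).im ^ 2 - 1) / ((x i).re ^ 2 + (x i).im ^ 2 + 1))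

theorem posSemidef_inv_cosh_dist :
    (Matrix.of fun i j => (Real.cosh (dist (x i) (x j)))⁻¹).PosSemidef := by
  have h : (Matrix.of fun i j => (Real.cosh (dist (x i) (x j)))⁻¹) =
      (Matrix.of fun i j => (hyperboloidTime (x i))⁻¹ * (hyperboloidTime (x j))⁻¹) ⊙
        (Matrix.of fun i j => kleinInner (x i) (x j)).map fun t => (1 - t)⁻¹ := by
    ext i j
    simp only [of_apply, hadamard_apply, map_apply, cosh_dist_eq_mul_one_sub_kleinInner, mul_inv]
  rw [h]
  exact (PosSemidef.of_mul_apply _).hadamard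
    ((posSemidef_kleinInner x).map_inv_one_sub fun i j => abs_kleinInner_lt_one _ _)

theorem posSemidef_one_sub_sqrt :
    (Matrix.of fun i j => 1 - √(1 - (Real.cosh (dist (x i) (x j)))⁻¹ ^ 2)).PosSemidef :=
  ((posSemidef_inv_cosh_dist x).map_pow 2).map_one_sub_sqrt_one_sub
    (fun _ _ => sq_nonneg _)
    (fun _ _ => pow_le_one₀ (inv_nonneg.2 (Real.cosh_pos _).le)
      (inv_le_one_of_one_le₀ (Real.one_le_cosh _)))

end UpperHalfPlane

open UpperHalfPlane

/-- The real hyperbolic plane (the upper half-plane with its hyperbolic metric)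
has negative type. -/
theorem upperHalfPlane_negativeType (n : ℕ) (hn : 1 ≤ n)
    (x : Fin n → UpperHalfPlane) (α : Fin n → ℝ) (hα : ∑ i, α i = 0) :
    ∑ i, ∑ j, α i * α j * dist (x i) (x j) ≤ 0 := by
  have hA := (posSemidef_real_iff_sum.1 ((posSemidef_kleinInner x).map_neg_log_one_sub
    fun i j => abs_kleinInner_lt_one _ _)).2 α
  have hB := (posSemidef_real_iff_sum.1
    (((posSemidef_one_sub_sqrt x).smul (show (0 : ℝ) ≤ 1 / 2 by norm_num)).map_neg_log_one_sub
    fun i j => by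
      have h0 := Real.sqrt_nonneg (1 - (Real.cosh (dist (x i) (x j)))⁻¹ ^ 2)
      have h1 : √(1 - (Real.cosh (dist (x i) (x j)))⁻¹ ^ 2) ≤ 1 :=
        Real.sqrt_le_one.2 (sub_le_self _ (sq_nonneg _))
      simp only [Matrix.smul_apply, Matrix.of_apply, smul_eq_mul, abs_lt]
      constructor <;> linarith)).2 α
  simp only [Matrix.map_apply, Matrix.smul_apply, Matrix.of_apply, smul_eq_mul] at hA hB
  have hC : ∑ i, ∑ j, α i * α j * (Real.log (hyperboloidTime (x i)) +
      Real.log (hyperboloidTime (x j)) + Real.log 2) = 0 := by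
    have h (i j : Fin n) : α i * α j * (Real.log (hyperboloidTime (x i)) +
        Real.log (hyperboloidTime (x j)) + Real.log 2) =
        α i * Real.log (hyperboloidTime (x i)) * α j +
          α i * (α j * (Real.log (hyperboloidTime (x j)) + Real.log 2)) := by ring
    simp only [h, Finset.sum_add_distrib, ← Finset.mul_sum, ← Finset.sum_mul, hα, mul_zero,
      zero_mul, add_zero, Finset.sum_const_zero]
  have hD : ∑ i, ∑ j, α i * α j * dist (x i) (x j) =
      ∑ i, ∑ j, α i * α j * (Real.log (hyperboloidTime (x i)) +
        Real.log (hyperboloidTime (x j)) + Real.log 2) -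
      ∑ i, ∑ j, α i * α j * -Real.log (1 - kleinInner (x i) (x j)) -
      ∑ i, ∑ j, α i * α j *
        -Real.log (1 - 1 / 2 * (1 - √(1 - (Real.cosh (dist (x i) (x j)))⁻¹ ^ 2))) := by
    simp only [← Finset.sum_sub_distrib]
    refine Finset.sum_congr rfl fun i _ => Finset.sum_congr rfl fun j _ => ?_
    linear_combination (α i * α j) * dist_eq_log_add_log (x i) (x j)
  linarith
end

section
/- The real hyperbolic plane (Mathlib's `UpperHalfPlane` with its hyperbolic metric) has strict negative type: for all n ≥ 1, all pairwise distinct points x₁,…,xₙ in the hyperbolic plane, and all reals α₁,…,αₙ with Σᵢ αᵢ = 0, if Σᵢⱼ αᵢαⱼ d(xᵢ,xⱼ) = 0 then αᵢ = 0 for all i. -/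
open Filter Topology

lemma sum_sum_insert_mul_min_sub {ι : Type*} [DecidableEq ι] (α t : ι → ℝ) (c : ℝ) {a : ι}
    {s : Finset ι} (ha : a ∉ s) (hmin : ∀ i ∈ s, t a ≤ t i) :
    ∑ i ∈ insert a s, ∑ j ∈ insert a s, α i * α j * (min (t i) (t j) - c) =
      (t a - c) * (∑ i ∈ insert a s, α i) ^ 2 +
        ∑ i ∈ s, ∑ j ∈ s, α i * α j * (min (t i) (t j) - t a) := by
  have key : ∑ i ∈ insert a s, ∑ j ∈ insert a s, α i * α j * (min (t i) (t j) - t a) =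
      ∑ i ∈ s, ∑ j ∈ s, α i * α j * (min (t i) (t j) - t a) := by
    have hl : ∀ j ∈ s, min (t a) (t j) = t a := fun j hj => min_eq_left (hmin j hj)
    have hr : ∀ j ∈ s, min (t j) (t a) = t a := fun j hj => min_eq_right (hmin j hj)
    rw [Finset.sum_insert ha, Finset.sum_insert ha, min_self, sub_self, mul_zero, zero_add,
      Finset.sum_eq_zero fun j hj => by rw [hl j hj, sub_self, mul_zero], zero_add]
    refine Finset.sum_congr rfl fun i hi => ?_
    rw [Finset.sum_insert ha, hr i hi, sub_self, mul_zero, zero_add]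
  rw [← key, sq, Finset.sum_mul_sum, Finset.mul_sum, ← Finset.sum_add_distrib]
  refine Finset.sum_congr rfl fun i _ => ?_
  rw [Finset.mul_sum, ← Finset.sum_add_distrib]
  exact Finset.sum_congr rfl fun j _ => by ring

lemma sum_sum_mul_min_sub_nonneg {ι : Type*} (α t : ι → ℝ) (s : Finset ι) :
    ∀ c : ℝ, (∀ i ∈ s, c ≤ t i) →
      0 ≤ ∑ i ∈ s, ∑ j ∈ s, α i * α j * (min (t i) (t j) - c) := by
  classical
  induction s using Finset.induction_on_min_value t with
  | empty => simp
  | insert a s ha hmin ih =>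
    intro c hc
    rw [sum_sum_insert_mul_min_sub α t c ha hmin]
    have := sub_nonneg.2 (hc a (Finset.mem_insert_self a s))
    have := ih (t a) hmin
    positivity

lemma eq_zero_of_sum_sum_mul_min_sub_eq_zero {ι : Type*} (α t : ι → ℝ)
    (ht : Function.Injective t) (s : Finset ι) :
    ∀ c : ℝ, (∀ i ∈ s, c < t i) →
      ∑ i ∈ s, ∑ j ∈ s, α i * α j * (min (t i) (t j) - c) = 0 → ∀ i ∈ s, α i = 0 := by
  classical
  induction s using Finset.induction_on_min_value t with
  | empty => simp
  | insert a s ha hmin ih =>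
    intro c hc h
    rw [sum_sum_insert_mul_min_sub α t c ha hmin] at h
    have hpos := sub_pos.2 (hc a (Finset.mem_insert_self a s))
    have h₂ := sum_sum_mul_min_sub_nonneg α t s (t a) hmin
    have h₁ : 0 ≤ (t a - c) * (∑ i ∈ insert a s, α i) ^ 2 := by positivity
    obtain ⟨h₁, h₂⟩ := (add_eq_zero_iff_of_nonneg h₁ h₂).1 h
    have hs := ih (t a) (fun i hi => lt_of_le_of_ne (hmin i hi) fun e => ha (ht e ▸ hi)) h₂
    have hsum : ∑ i ∈ insert a s, α i = 0 := by simpa [hpos.ne'] using h₁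
    rw [Finset.sum_insert ha, Finset.sum_eq_zero hs, add_zero] at hsum
    simpa [hsum] using hs

lemma sum_sum_mul_abs_sub {ι : Type*} [Fintype ι] (α t : ι → ℝ) (hα : ∑ i, α i = 0) :
    ∑ i, ∑ j, α i * α j * |t i - t j| = -2 * ∑ i, ∑ j, α i * α j * (min (t i) (t j) - 0) := by
  have h (i j) : α i * α j * |t i - t j| =
      (α i * t i) * α j + α i * (α j * t j) + -2 * (α i * α j * (min (t i) (t j) - 0)) := by
    rcases le_total (t i) (t j) with h | h
    · rw [min_eq_left h, abs_of_nonpos (by linarith)]; ring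
    · rw [min_eq_right h, abs_of_nonneg (by linarith)]; ring
  simp_rw [h, Finset.sum_add_distrib, ← Finset.mul_sum, ← Finset.sum_mul, hα]
  simp

/-- The reciprocal of the Euclidean distance from `a` on the real axis to `z`. -/
noncomputable def recipDist (z : UpperHalfPlane) (a : ℝ) : ℝ :=
  (√((a - z.re) ^ 2 + z.im ^ 2))⁻¹

lemma sq_add_im_sq_pos (z : UpperHalfPlane) (a : ℝ) : 0 < (a - z.re) ^ 2 + z.im ^ 2 := by
  have := z.im_pos
  positivity

lemma recipDist_pos (z : UpperHalfPlane) (a : ℝ) : 0 < recipDist z a :=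
  inv_pos.2 (Real.sqrt_pos.2 (sq_add_im_sq_pos z a))

lemma recipDist_le_recipDist_iff {z w : UpperHalfPlane} {a : ℝ} :
    recipDist z a ≤ recipDist w a ↔
      (a - w.re) ^ 2 + w.im ^ 2 ≤ (a - z.re) ^ 2 + z.im ^ 2 := by
  rw [recipDist, recipDist, inv_le_inv₀ (Real.sqrt_pos.2 (sq_add_im_sq_pos z a))
    (Real.sqrt_pos.2 (sq_add_im_sq_pos w a)), Real.sqrt_le_sqrt_iff (sq_add_im_sq_pos z a).le]

lemma continuous_recipDist (z : UpperHalfPlane) : Continuous (recipDist z) :=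
  Continuous.inv₀ (by fun_prop) fun a => (Real.sqrt_pos.2 (sq_add_im_sq_pos z a)).ne'

lemma sqrt_one_add_div_sq (z : UpperHalfPlane) (a : ℝ) :
    √(1 + ((a - z.re) / z.im) ^ 2) = √((a - z.re) ^ 2 + z.im ^ 2) / z.im := by
  have := z.im_pos
  rw [← Real.sqrt_sq this.le, ← Real.sqrt_div' _ (by positivity), Real.sqrt_sq this.le]
  congr 1
  field_simp
  ring

lemma hasDerivAt_arsinh_recipDist (z : UpperHalfPlane) (a : ℝ) :
    HasDerivAt (fun a => Real.arsinh ((a - z.re) / z.im)) (recipDist z a) a := by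
  have := z.im_pos
  have h := (((hasDerivAt_id a).sub_const z.re).div_const z.im).arsinh
  refine h.congr_deriv ?_
  simp only [id, sqrt_one_add_div_sq, recipDist, smul_eq_mul]
  field_simp

lemma tendsto_arsinh_sub_log (b : ℝ) {q : ℝ} (hq : 0 < q) :
    Tendsto (fun R => Real.arsinh ((R + b) / q) - Real.log R) atTop (𝓝 (Real.log (2 / q))) := by
  have hinv : Tendsto (fun R : ℝ => R⁻¹) atTop (𝓝 0) := tendsto_inv_atTop_zero
  have hF : Continuous fun u : ℝ => (1 + b * u) / q + √(u ^ 2 + ((1 + b * u) / q) ^ 2) := by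
    fun_prop
  have h := (hF.tendsto 0).comp hinv
  have e : (1 + b * 0) / q + √((0 : ℝ) ^ 2 + ((1 + b * 0) / q) ^ 2) = 2 / q := by
    simp [Real.sqrt_sq hq.le]; ring
  simp only [e] at h
  refine (h.log (by positivity)).congr' ?_
  filter_upwards [eventually_gt_atTop 0] with R hR
  have hs : √(R⁻¹ ^ 2 + ((1 + b * R⁻¹) / q) ^ 2) = √(1 + ((R + b) / q) ^ 2) / R := by
    rw [eq_div_iff hR.ne', ← Real.sqrt_sq hR.le, ← Real.sqrt_mul' _ (by positivity),
      Real.sqrt_sq hR.le]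
    congr 1
    field_simp
  have hp : 0 < (R + b) / q + √(1 + ((R + b) / q) ^ 2) := by
    rw [← Real.exp_arsinh]; positivity
  rw [Real.arsinh, ← Real.log_div hp.ne' hR.ne']
  simp only [Function.comp, hs]
  congr 1
  field_simp

lemma tendsto_arsinh_add_arsinh_neg (z : UpperHalfPlane) :
    Tendsto (fun R => Real.arsinh ((R - z.re) / z.im) + Real.arsinh ((-R - z.re) / z.im))
      atTop (𝓝 0) := by
  have h := (tendsto_arsinh_sub_log (-z.re) z.im_pos).sub (tendsto_arsinh_sub_log z.re z.im_pos)
  rw [sub_self] at h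
  refine h.congr fun R => ?_
  rw [show (-R - z.re) / z.im = -((R + z.re) / z.im) by ring, Real.arsinh_neg, sub_eq_add_neg R]
  ring

lemma intervalIntegrable_recipDist (z : UpperHalfPlane) (a b : ℝ) :
    IntervalIntegrable (recipDist z) MeasureTheory.volume a b :=
  (continuous_recipDist z).intervalIntegrable a b

lemma integral_recipDist_sub (z w : UpperHalfPlane) (a b : ℝ) :
    ∫ u in a..b, (recipDist z u - recipDist w u) =
      (Real.arsinh ((b - z.re) / z.im) - Real.arsinh ((b - w.re) / w.im)) -
        (Real.arsinh ((a - z.re) / z.im) - Real.arsinh ((a - w.re) / w.im)) :=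
  intervalIntegral.integral_eq_sub_of_hasDerivAt
    (fun u _ => (hasDerivAt_arsinh_recipDist z u).sub (hasDerivAt_arsinh_recipDist w u))
    ((intervalIntegrable_recipDist z a b).sub (intervalIntegrable_recipDist w a b))

lemma integral_abs_recipDist_sub {z w : UpperHalfPlane} {a b : ℝ} (hab : a ≤ b)
    (h : ∀ u ∈ Set.Icc a b, recipDist w u ≤ recipDist z u) :
    ∫ u in a..b, |recipDist z u - recipDist w u| =
      (Real.arsinh ((b - z.re) / z.im) - Real.arsinh ((b - w.re) / w.im)) -
        (Real.arsinh ((a - z.re) / z.im) - Real.arsinh ((a - w.re) / w.im)) := by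
  rw [← integral_recipDist_sub]
  refine intervalIntegral.integral_congr fun u hu => ?_
  rw [Set.uIcc_of_le hab] at hu
  exact abs_of_nonneg (sub_nonneg.2 (h u hu))

lemma tendsto_integral_of_re_eq {z w : UpperHalfPlane} (hre : z.re = w.re) (him : z.im ≤ w.im) :
    Tendsto (fun R => ∫ u in -R..R, |recipDist z u - recipDist w u|) atTop
      (𝓝 (2 * dist z w)) := by
  have hz := (tendsto_arsinh_sub_log (-z.re) z.im_pos).add (tendsto_arsinh_sub_log z.re z.im_pos)
  have hw := (tendsto_arsinh_sub_log (-w.re) w.im_pos).add (tendsto_arsinh_sub_log w.re w.im_pos)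
  have hd : 2 * dist z w = Real.log (2 / z.im) + Real.log (2 / z.im) -
      (Real.log (2 / w.im) + Real.log (2 / w.im)) := by
    rw [UpperHalfPlane.dist_of_re_eq hre, Real.dist_eq,
      abs_of_nonpos (sub_nonpos.2 (Real.log_le_log z.im_pos him)),
      Real.log_div two_ne_zero z.im_ne_zero, Real.log_div two_ne_zero w.im_ne_zero]
    ring
  rw [hd]
  refine (hz.sub hw).congr' ?_
  filter_upwards [eventually_ge_atTop 0] with R hR
  rw [integral_abs_recipDist_sub (by linarith) fun u _ => recipDist_le_recipDist_iff.2 ?_]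
  · rw [show (-R - z.re) / z.im = -((R + z.re) / z.im) by ring,
      show (-R - w.re) / w.im = -((R + w.re) / w.im) by ring, Real.arsinh_neg, Real.arsinh_neg,
      sub_eq_add_neg R, sub_eq_add_neg R]
    ring
  · rw [hre]
    have := z.im_pos
    gcongr

lemma cosh_arsinh_sub_arsinh {z w : UpperHalfPlane} {c : ℝ}
    (hc : (c - z.re) ^ 2 + z.im ^ 2 = (c - w.re) ^ 2 + w.im ^ 2) :
    Real.cosh (Real.arsinh ((c - z.re) / z.im) - Real.arsinh ((c - w.re) / w.im)) =
      Real.cosh (dist z w) := by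
  have hz := z.im_ne_zero
  have hw := w.im_ne_zero
  have hr := Real.mul_self_sqrt (sq_add_im_sq_pos w c).le
  rw [Real.cosh_sub, Real.cosh_arsinh, Real.cosh_arsinh, Real.sinh_arsinh, Real.sinh_arsinh,
    sqrt_one_add_div_sq, sqrt_one_add_div_sq, hc, UpperHalfPlane.cosh_dist', div_mul_div_comm, hr]
  field_simp
  linear_combination -hc

lemma tendsto_integral_of_re_lt {z w : UpperHalfPlane} (hre : z.re < w.re) :
    Tendsto (fun R => ∫ u in -R..R, |recipDist z u - recipDist w u|) atTop
      (𝓝 (2 * dist z w)) := by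
  set c : ℝ := (w.re ^ 2 + w.im ^ 2 - z.re ^ 2 - z.im ^ 2) / (2 * (w.re - z.re)) with hc
  have hpos : 0 < w.re - z.re := sub_pos.2 hre
  have hdiff (u : ℝ) : (u - w.re) ^ 2 + w.im ^ 2 - ((u - z.re) ^ 2 + z.im ^ 2) =
      2 * (w.re - z.re) * (c - u) := by
    rw [hc]; field_simp; ring
  set K := Real.arsinh ((c - z.re) / z.im) - Real.arsinh ((c - w.re) / w.im) with hK
  have hlim : Tendsto (fun R => ∫ u in -R..R, |recipDist z u - recipDist w u|) atTop
      (𝓝 (2 * K)) := by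
    have h := ((tendsto_arsinh_add_arsinh_neg w).sub (tendsto_arsinh_add_arsinh_neg z)).const_add
      (2 * K)
    rw [sub_self, add_zero] at h
    refine h.congr' ?_
    filter_upwards [eventually_ge_atTop |c|] with R hR
    obtain ⟨h₁, h₂⟩ := abs_le.1 hR
    have hint (a b : ℝ) : IntervalIntegrable (fun u => |recipDist z u - recipDist w u|)
        MeasureTheory.volume a b :=
      ((intervalIntegrable_recipDist z a b).sub (intervalIntegrable_recipDist w a b)).abs
    rw [← intervalIntegral.integral_add_adjacent_intervals (hint (-R) c) (hint c R),
      integral_abs_recipDist_sub h₁ fun u hu => recipDist_le_recipDist_iff.2 ?_]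
    · simp_rw [abs_sub_comm (recipDist z _)]
      rw [integral_abs_recipDist_sub h₂ fun u hu => recipDist_le_recipDist_iff.2 ?_]
      · ring
      · nlinarith [hdiff u, hu.1]
    · nlinarith [hdiff u, hu.2]
  have hK0 : 0 ≤ 2 * K := by
    refine ge_of_tendsto hlim ?_
    filter_upwards [eventually_ge_atTop 0] with R hR
    exact intervalIntegral.integral_nonneg (by linarith) fun u _ => abs_nonneg _
  have hcosh : Real.cosh K = Real.cosh (dist z w) :=
    cosh_arsinh_sub_arsinh (by linarith [hdiff c, mul_zero (2 * (w.re - z.re)), sub_self c])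
  have : K = dist z w := by
    rw [← abs_of_nonneg (by linarith : 0 ≤ K), ← abs_of_nonneg (dist_nonneg : 0 ≤ dist z w)]
    exact le_antisymm (Real.cosh_le_cosh.1 hcosh.le) (Real.cosh_le_cosh.1 hcosh.ge)
  rwa [this] at hlim

/-- A Crofton formula: the hyperbolic distance is half the `L¹` distance of the functions
`recipDist z` and `recipDist w` on the real axis. -/
lemma tendsto_integral_abs_recipDist_sub (z w : UpperHalfPlane) :
    Tendsto (fun R => ∫ u in -R..R, |recipDist z u - recipDist w u|) atTop
      (𝓝 (2 * dist z w)) := by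
  rcases lt_trichotomy z.re w.re with h | h | h
  · exact tendsto_integral_of_re_lt h
  · rcases le_total z.im w.im with h' | h'
    · exact tendsto_integral_of_re_eq h h'
    · simpa only [abs_sub_comm, dist_comm] using tendsto_integral_of_re_eq h.symm h'
  · simpa only [abs_sub_comm, dist_comm] using tendsto_integral_of_re_lt h

lemma finite_setOf_recipDist_eq {z w : UpperHalfPlane} (h : z ≠ w) :
    {a | recipDist z a = recipDist w a}.Finite := by
  refine Set.Subsingleton.finite fun a ha b hb => ?_
  by_contra hab
  have key {u : ℝ} (hu : recipDist z u = recipDist w u) :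
      (u - z.re) ^ 2 + z.im ^ 2 = (u - w.re) ^ 2 + w.im ^ 2 :=
    le_antisymm (recipDist_le_recipDist_iff.1 hu.ge) (recipDist_le_recipDist_iff.1 hu.le)
  have h₁ := key ha
  have h₂ := key hb
  have hre : z.re = w.re := by
    refine mul_left_cancel₀ (sub_ne_zero.2 hab) ?_
    linear_combination (h₂ - h₁) / 2
  rw [hre, add_right_inj, sq_eq_sq₀ z.im_pos.le w.im_pos.le] at h₁
  exact h (UpperHalfPlane.ext_re_im hre h₁)

lemma exists_injective_recipDist {ι : Type*} [Finite ι] {x : ι → UpperHalfPlane}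
    (hx : Function.Injective x) : ∃ a, Function.Injective fun i => recipDist (x i) a := by
  have hfin : (⋃ i, ⋃ j, ⋃ _ : i ≠ j, {a | recipDist (x i) a = recipDist (x j) a}).Finite :=
    Set.finite_iUnion fun i => Set.finite_iUnion fun j => Set.finite_iUnion fun hij =>
      finite_setOf_recipDist_eq (hx.ne hij)
  obtain ⟨a, ha⟩ := hfin.exists_notMem
  refine ⟨a, fun i j hij => ?_⟩
  by_contra hne
  exact ha (Set.mem_iUnion.2 ⟨i, Set.mem_iUnion.2 ⟨j, Set.mem_iUnion.2 ⟨hne, hij⟩⟩⟩)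

lemma eq_zero_of_tendsto_integral_zero {Q : ℝ → ℝ} (hQ : Continuous Q) (h0 : ∀ u, 0 ≤ Q u)
    (h : Tendsto (fun R => ∫ u in -R..R, Q u) atTop (𝓝 0)) (a : ℝ) : Q a = 0 := by
  by_contra ha
  have hlt : |a| < |a| + 1 := by linarith
  obtain ⟨h₁, h₂⟩ := abs_lt.1 hlt
  have hpos : 0 < ∫ u in -(|a| + 1)..(|a| + 1), Q u :=
    intervalIntegral.integral_pos (by linarith) hQ.continuousOn (fun u _ => h0 u)
      ⟨a, ⟨h₁.le, h₂.le⟩, (h0 a).lt_of_ne' ha⟩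
  refine hpos.not_ge (ge_of_tendsto h ?_)
  filter_upwards [eventually_ge_atTop (|a| + 1)] with R hR
  exact intervalIntegral.integral_mono_interval (by linarith) (by linarith) hR
    (Eventually.of_forall h0) (hQ.intervalIntegrable _ _)

/-- The real hyperbolic plane (the upper half-plane with its hyperbolic metric)
has strict negative type. -/
theorem upperHalfPlane_strictNegativeType (n : ℕ) (hn : 1 ≤ n)
    (x : Fin n → UpperHalfPlane) (hx : Function.Injective x)
    (α : Fin n → ℝ) (hα : ∑ i, α i = 0)
    (h : ∑ i, ∑ j, α i * α j * dist (x i) (x j) = 0) :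
    ∀ i, α i = 0 := by
  set Q : ℝ → ℝ := fun u =>
    ∑ i, ∑ j, α i * α j * (min (recipDist (x i) u) (recipDist (x j) u) - 0) with hQ
  have hcont (i) : Continuous (recipDist (x i)) := continuous_recipDist (x i)
  have hQcont : Continuous Q := by fun_prop
  have hQabs (u : ℝ) : Q u =
      ∑ i, ∑ j, -(α i * α j / 2) * |recipDist (x i) u - recipDist (x j) u| := by
    have := sum_sum_mul_abs_sub α (fun i => recipDist (x i) u) hα
    calc Q u = -(1 / 2) * ∑ i, ∑ j, α i * α j * |recipDist (x i) u - recipDist (x j) u| := by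
          rw [this]; simp only [hQ]; ring
      _ = _ := by
        simp_rw [Finset.mul_sum]
        exact Finset.sum_congr rfl fun i _ => Finset.sum_congr rfl fun j _ => by ring
  have hlim : Tendsto (fun R => ∫ u in -R..R, Q u) atTop (𝓝 0) := by
    have hsum : Tendsto (fun R => ∑ i, ∑ j, -(α i * α j / 2) *
        ∫ u in -R..R, |recipDist (x i) u - recipDist (x j) u|) atTop
        (𝓝 (∑ i, ∑ j, -(α i * α j / 2) * (2 * dist (x i) (x j)))) :=
      tendsto_finsetSum _ fun i _ => tendsto_finsetSum _ fun j _ =>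
        (tendsto_integral_abs_recipDist_sub (x i) (x j)).const_mul _
    have h0 : ∑ i, ∑ j, -(α i * α j / 2) * (2 * dist (x i) (x j)) = 0 := by
      rw [← neg_eq_zero, ← h, ← Finset.sum_neg_distrib]
      refine Finset.sum_congr rfl fun i _ => ?_
      rw [← Finset.sum_neg_distrib]
      exact Finset.sum_congr rfl fun j _ => by ring
    rw [h0] at hsum
    refine hsum.congr fun R => ?_
    simp_rw [hQabs]
    rw [intervalIntegral.integral_finsetSum fun i _ =>
      Continuous.intervalIntegrable (by fun_prop) _ _]
    refine Finset.sum_congr rfl fun i _ => ?_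
    rw [intervalIntegral.integral_finsetSum fun j _ =>
      Continuous.intervalIntegrable (by fun_prop) _ _]
    exact Finset.sum_congr rfl fun j _ => (intervalIntegral.integral_const_mul _ _).symm
  have hQ0 (u : ℝ) : 0 ≤ Q u :=
    sum_sum_mul_min_sub_nonneg α _ Finset.univ 0 fun i _ => (recipDist_pos (x i) u).le
  obtain ⟨a, ha⟩ := exists_injective_recipDist hx
  intro i
  exact eq_zero_of_sum_sum_mul_min_sub_eq_zero α _ ha Finset.univ 0
    (fun i _ => recipDist_pos (x i) a) (eq_zero_of_tendsto_integral_zero hQcont hQ0 hlim a)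
    i (Finset.mem_univ i)
end

section
/- Let (X,d) be a metric space of negative type. Then for all Borel probability measures μ₁, μ₂ on X with finite first moment, ∫∫ d(x,y) d(μ₁−μ₂)²(x,y) ≤ 0, i.e. ∫∫ d dμ₁dμ₁ + ∫∫ d dμ₂dμ₂ ≤ 2 ∫∫ d dμ₁dμ₂. -/
open MeasureTheory

open scoped RealInnerProductSpace

universe u

/-- Moore's theorem for real kernels: a symmetric positive semidefinite kernel is the Gram kernel
of a map into a Hilbert space. -/
theorem exists_inner_eq_of_posSemidef {X : Type u} (k : X → X → ℝ)
    (hsymm : ∀ x y, k x y = k y x)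
    (hpos : ∀ f : X →₀ ℝ, 0 ≤ f.sum fun x a => f.sum fun y b => k x y * a * b) :
    ∃ (H : Type u) (_ : NormedAddCommGroup H) (_ : InnerProductSpace ℝ H) (_ : CompleteSpace H)
      (φ : X → H), ∀ x y, ⟪φ x, φ y⟫ = k x y := by
  let K : Matrix X X (ℝ →L[ℝ] ℝ) := .of fun x y => k x y • (1 : ℝ →L[ℝ] ℝ)
  have hK : K.PosSemidef := by
    have iff_quadratic := (RKHS.posSemidef_tfae (K := K)).out 0 2
    refine iff_quadratic.mpr ⟨?_, fun f => ?_⟩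
    · ext x y
      simp [K, Matrix.conjTranspose_apply, hsymm x y]
    · refine (hpos f).trans_eq ?_
      simp only [RCLike.re_to_real]
      refine Finsupp.sum_congr fun x _ => Finsupp.sum_congr fun y _ => ?_
      simp [K, hsymm x y]
      ring
  have : Fact K.PosSemidef := ⟨hK⟩
  refine ⟨RKHS.OfKernel K, inferInstance, inferInstance, inferInstance,
    fun x => RKHS.kerFun (RKHS.OfKernel K) x 1, fun x y => ?_⟩
  rw [← RKHS.kernel_inner, RKHS.OfKernel.kernel_ofKernel]
  simp [K, hsymm x y]

/-- In a space of negative type, the kernel `(d(x,o) + d(y,o) - d(x,y)) / 2` is positive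
semidefinite. -/
theorem gromovProduct_posSemidef {X : Type*} [PseudoMetricSpace X]
    (hneg : ∀ (n : ℕ), 1 ≤ n → ∀ (x : Fin n → X) (α : Fin n → ℝ),
      ∑ i, α i = 0 → ∑ i, ∑ j, α i * α j * dist (x i) (x j) ≤ 0)
    (o : X) (f : X →₀ ℝ) :
    0 ≤ f.sum fun x a => f.sum fun y b =>
      (dist x o + dist y o - dist x y) / 2 * a * b := by
  classical
  let e := f.support.equivFin
  have transfer : ∀ g : X → ℝ, ∑ i, g (e.symm i) = ∑ x ∈ f.support, g x := fun g => by
    rw [Equiv.sum_comp e.symm (fun x : f.support => g x), Finset.sum_coe_sort]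
  have key := hneg (f.support.card + 1) (by omega)
    (Fin.cons o fun i => (e.symm i : X))
    (Fin.cons (-∑ x ∈ f.support, f x) fun i => f (e.symm i))
    (by simp [Fin.sum_univ_succ, transfer fun x => f x])
  simp only [Fin.sum_univ_succ, Fin.cons_zero, Fin.cons_succ, dist_self, mul_zero, zero_add] at key
  rw [transfer fun x => -(∑ x ∈ f.support, f x) * f x * dist o x,
    transfer fun x => f x * -(∑ x ∈ f.support, f x) * dist x o +
      ∑ j, f x * f (e.symm j) * dist x (e.symm j)] at key
  simp only [fun x => transfer fun y => f x * f y * dist x y] at key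
  have expand : (f.sum fun x a => f.sum fun y b =>
      (dist x o + dist y o - dist x y) / 2 * a * b) =
      (∑ x ∈ f.support, f x) * (∑ x ∈ f.support, f x * dist x o)
        - (∑ x ∈ f.support, ∑ y ∈ f.support, f x * f y * dist x y) / 2 := by
    have left : ∑ x ∈ f.support, ∑ y ∈ f.support, f x * dist x o * f y =
        (∑ x ∈ f.support, f x * dist x o) * ∑ x ∈ f.support, f x :=
      (Finset.sum_mul_sum ..).symm
    have right : ∑ x ∈ f.support, ∑ y ∈ f.support, f x * (f y * dist y o) =
        (∑ x ∈ f.support, f x) * ∑ x ∈ f.support, f x * dist x o :=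
      (Finset.sum_mul_sum ..).symm
    calc _ = ∑ x ∈ f.support, ∑ y ∈ f.support, (f x * dist x o * f y / 2
          + f x * (f y * dist y o) / 2 - f x * f y * dist x y / 2) :=
          Finset.sum_congr rfl fun x _ => Finset.sum_congr rfl fun y _ => by ring
      _ = _ := by
          simp only [Finset.sum_sub_distrib, Finset.sum_add_distrib, ← Finset.sum_div]
          rw [left, right]
          ring
  rw [expand]
  have cross : ∑ x ∈ f.support, -(∑ x ∈ f.support, f x) * f x * dist o x =
      -((∑ x ∈ f.support, f x) * ∑ x ∈ f.support, f x * dist x o) := by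
    rw [← neg_mul, Finset.mul_sum]
    exact Finset.sum_congr rfl fun x _ => by rw [dist_comm o x]; ring
  have cross' : ∑ x ∈ f.support, f x * -(∑ x ∈ f.support, f x) * dist x o =
      -((∑ x ∈ f.support, f x) * ∑ x ∈ f.support, f x * dist x o) := by
    rw [← neg_mul, Finset.mul_sum]
    exact Finset.sum_congr rfl fun x _ => by ring
  rw [Finset.sum_add_distrib, cross, cross'] at key
  linarith

/-- Schoenberg's theorem: a space of negative type maps into a Hilbert space so that distances
become squared norms, with a prescribed point going to the origin. -/
theorem exists_norm_sub_sq_eq_dist {X : Type u} [PseudoMetricSpace X]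
    (hneg : ∀ (n : ℕ), 1 ≤ n → ∀ (x : Fin n → X) (α : Fin n → ℝ),
      ∑ i, α i = 0 → ∑ i, ∑ j, α i * α j * dist (x i) (x j) ≤ 0)
    (o : X) :
    ∃ (H : Type u) (_ : NormedAddCommGroup H) (_ : InnerProductSpace ℝ H) (_ : CompleteSpace H)
      (φ : X → H), (∀ x, ‖φ x‖ ^ 2 = dist o x) ∧ ∀ x y, ‖φ x - φ y‖ ^ 2 = dist x y := by
  obtain ⟨H, _, _, _, φ, hφ⟩ := exists_inner_eq_of_posSemidef
    (fun x y => (dist x o + dist y o - dist x y) / 2)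
    (fun x y => by rw [dist_comm x y, add_comm (dist x o)]) (gromovProduct_posSemidef hneg o)
  have norm_sq : ∀ x, ‖φ x‖ ^ 2 = dist o x := fun x => by
    rw [← real_inner_self_eq_norm_sq, hφ, dist_self, dist_comm o]
    ring
  refine ⟨H, ‹_›, ‹_›, ‹_›, φ, norm_sq, fun x y => ?_⟩
  rw [norm_sub_sq_real, norm_sq, norm_sq, hφ, dist_comm x o, dist_comm y o]
  ring

/-- A weakly integrable map into a Hilbert space with integrable norm has a weak (Pettis) mean. -/
theorem exists_inner_eq_integral_inner {X H : Type*} [MeasurableSpace X]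
    [NormedAddCommGroup H] [InnerProductSpace ℝ H] [CompleteSpace H] {μ : Measure X} {φ : X → H}
    (hnorm : Integrable (fun x => ‖φ x‖) μ) (hφ : ∀ h, Integrable (fun x => ⟪φ x, h⟫) μ) :
    ∃ m : H, ∀ h, ∫ x, ⟪φ x, h⟫ ∂μ = ⟪m, h⟫ := by
  let L : H →ₗ[ℝ] ℝ :=
    { toFun := fun h => ∫ x, ⟪φ x, h⟫ ∂μ
      map_add' := fun h h' => by
        simp only [inner_add_right]
        exact integral_add (hφ h) (hφ h')
      map_smul' := fun c h => by
        simp only [real_inner_smul_right]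
        exact integral_const_mul c _ }
  let T : H →L[ℝ] ℝ := L.mkContinuous (∫ x, ‖φ x‖ ∂μ) fun h => by
    rw [← integral_mul_const]
    exact norm_integral_le_of_norm_le (hnorm.mul_const _)
      (.of_forall fun x => norm_inner_le_norm (φ x) h)
  exact ⟨(InnerProductSpace.toDual ℝ H).symm T, fun h =>
    (InnerProductSpace.toDual_symm_apply (y := T)).symm⟩

/-- The mean distance between two measures, in terms of an embedding that turns distances into
squared norms and of the weak means of the measures under it. -/
theorem integral_integral_dist_eq {X H : Type*} [PseudoMetricSpace X] [MeasurableSpace X]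
    [NormedAddCommGroup H] [InnerProductSpace ℝ H] {φ : X → H}
    (hdist : ∀ x y, ‖φ x - φ y‖ ^ 2 = dist x y)
    {μ ν : Measure X} [IsProbabilityMeasure μ] [IsProbabilityMeasure ν]
    (hsqμ : Integrable (fun x => ‖φ x‖ ^ 2) μ) (hsqν : Integrable (fun x => ‖φ x‖ ^ 2) ν)
    (hμ : ∀ h, Integrable (fun x => ⟪φ x, h⟫) μ) (hν : ∀ h, Integrable (fun x => ⟪φ x, h⟫) ν)
    {m n : H} (hm : ∀ h, ∫ x, ⟪φ x, h⟫ ∂μ = ⟪m, h⟫) (hn : ∀ h, ∫ x, ⟪φ x, h⟫ ∂ν = ⟪n, h⟫) :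
    ∫ x, ∫ y, dist x y ∂ν ∂μ =
      (∫ x, ‖φ x‖ ^ 2 ∂μ) + (∫ x, ‖φ x‖ ^ 2 ∂ν) - 2 * ⟪m, n⟫ := by
  have inner_integral : ∀ x, ∫ y, dist x y ∂ν =
      ‖φ x‖ ^ 2 + (∫ y, ‖φ y‖ ^ 2 ∂ν) - 2 * ⟪φ x, n⟫ := fun x => by
    have : ∀ y, dist x y = ‖φ x‖ ^ 2 + ‖φ y‖ ^ 2 - 2 * ⟪φ y, φ x⟫ := fun y => by
      rw [← hdist, norm_sub_sq_real, real_inner_comm]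
      ring
    have hadd : Integrable (fun y => ‖φ x‖ ^ 2 + ‖φ y‖ ^ 2) ν := (integrable_const _).add hsqν
    simp only [this]
    rw [integral_sub hadd ((hν _).const_mul 2),
      integral_add (integrable_const _) hsqν, integral_const_mul, hn, real_inner_comm]
    simp
  have hadd : Integrable (fun x => ‖φ x‖ ^ 2 + ∫ y, ‖φ y‖ ^ 2 ∂ν) μ :=
    hsqμ.add (integrable_const _)
  simp only [inner_integral]
  rw [integral_sub hadd ((hμ _).const_mul 2),
    integral_add hsqμ (integrable_const _), integral_const_mul, hm]
  simp

/-- If a metric space has negative type, then for all Borel probability measures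
`μ₁, μ₂` with finite first moment, `∫∫ d d(μ₁-μ₂)² ≤ 0`, i.e.
`∫∫ d dμ₁dμ₁ + ∫∫ d dμ₂dμ₂ ≤ 2 ∫∫ d dμ₁dμ₂`. -/
theorem negativeType_measure_ineq {X : Type*} [MetricSpace X]
    [MeasurableSpace X] [BorelSpace X]
    (hneg : ∀ (n : ℕ), 1 ≤ n → ∀ (x : Fin n → X) (α : Fin n → ℝ),
      ∑ i, α i = 0 → ∑ i, ∑ j, α i * α j * dist (x i) (x j) ≤ 0)
    (μ₁ μ₂ : Measure X) [IsProbabilityMeasure μ₁] [IsProbabilityMeasure μ₂]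
    (h₁ : ∃ o, Integrable (fun x => dist o x) μ₁)
    (h₂ : ∃ o, Integrable (fun x => dist o x) μ₂) :
    (∫ x, ∫ y, dist x y ∂μ₁ ∂μ₁) + (∫ x, ∫ y, dist x y ∂μ₂ ∂μ₂)
      ≤ 2 * ∫ x, ∫ y, dist x y ∂μ₂ ∂μ₁ := by
  obtain ⟨o, ho⟩ := h₁
  obtain ⟨o', ho'⟩ := h₂
  obtain ⟨H, _, _, _, φ, hnorm, hdist⟩ := exists_norm_sub_sq_eq_dist hneg o
  have hcont : Continuous φ := by
    refine continuous_iff_continuousAt.2 fun x => tendsto_iff_norm_sub_tendsto_zero.2 ?_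
    have hlim : Filter.Tendsto (fun y => √(dist y x)) (nhds x) (nhds √(dist x x)) :=
      (continuous_id.dist continuous_const).sqrt.tendsto x
    simpa [← hdist] using hlim
  have hsq₁ : Integrable (fun x => ‖φ x‖ ^ 2) μ₁ := by simpa only [hnorm] using ho
  have hsq₂ : Integrable (fun x => ‖φ x‖ ^ 2) μ₂ := by
    simp only [hnorm]
    refine ((integrable_const (dist o o')).add ho').mono'
      (continuous_const.dist continuous_id).aestronglyMeasurable (.of_forall fun x => ?_)
    simpa using dist_triangle o o' x
  have integrable_norm : ∀ (μ : Measure X) [IsProbabilityMeasure μ],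
      Integrable (fun x => ‖φ x‖ ^ 2) μ → Integrable (fun x => ‖φ x‖) μ := fun μ _ hsq =>
    ((integrable_const 1).add hsq).mono' hcont.norm.aestronglyMeasurable
      (.of_forall fun x => by
        simp only [norm_norm, Pi.add_apply]
        nlinarith [sq_nonneg (‖φ x‖ - 1), sq_nonneg ‖φ x‖])
  have integrable_inner : ∀ (μ : Measure X) [IsProbabilityMeasure μ],
      Integrable (fun x => ‖φ x‖ ^ 2) μ → ∀ h, Integrable (fun x => ⟪φ x, h⟫) μ :=
    fun μ _ hsq h => ((integrable_norm μ hsq).mul_const ‖h‖).mono'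
      (hcont.inner continuous_const).aestronglyMeasurable
      (.of_forall fun x => norm_inner_le_norm (φ x) h)
  have hin₁ := integrable_inner μ₁ hsq₁
  have hin₂ := integrable_inner μ₂ hsq₂
  obtain ⟨m₁, hm₁⟩ := exists_inner_eq_integral_inner (integrable_norm μ₁ hsq₁) hin₁
  obtain ⟨m₂, hm₂⟩ := exists_inner_eq_integral_inner (integrable_norm μ₂ hsq₂) hin₂
  rw [integral_integral_dist_eq hdist hsq₁ hsq₁ hin₁ hin₁ hm₁ hm₁,
    integral_integral_dist_eq hdist hsq₂ hsq₂ hin₂ hin₂ hm₂ hm₂,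
    integral_integral_dist_eq hdist hsq₁ hsq₂ hin₁ hin₂ hm₁ hm₂,
    real_inner_self_eq_norm_sq, real_inner_self_eq_norm_sq]
  linarith [sq_nonneg ‖m₁ - m₂‖, norm_sub_sq_real m₁ m₂]
end

section
/- Let (X,d) be a metric space with Borel σ-algebra, (Ω, 𝒜, σ) a measure space, and A ⊆ Ω × X a set measurable for the product σ-algebra, with sections A_ω = {x : (ω,x) ∈ A}, such that for all x, y ∈ X, σ({ω : exactly one of x, y lies in A_ω}) = d(x,y). Then (X,d) has negative type: for all n ≥ 1, all x₁,…,xₙ ∈ X and all reals α₁,…,αₙ with Σᵢ αᵢ = 0, one has Σᵢⱼ αᵢαⱼ d(xᵢ,xⱼ) ≤ 0. -/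
open MeasureTheory

/-- For weights of total mass zero, the quadratic form of squared differences is
minus twice the square of the weighted sum. -/
theorem sum_sum_mul_sub_sq_of_sum_eq_zero {ι R : Type*} [Fintype ι] [CommRing R]
    (α u : ι → R) (hα : ∑ i, α i = 0) :
    ∑ i, ∑ j, α i * α j * (u i - u j) ^ 2 = -2 * (∑ i, α i * u i) ^ 2 := by
  have expand : ∀ i j, α i * α j * (u i - u j) ^ 2 =
      α i * u i ^ 2 * α j + α i * (α j * u j ^ 2) - 2 * ((α i * u i) * (α j * u j)) := by
    intro i j
    ring
  simp only [expand, Finset.sum_sub_distrib, Finset.sum_add_distrib, ← Finset.mul_sum,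
    ← Finset.sum_mul, hα]
  ring

/-- If a measurable family of "cuts" `A` satisfies that the measure of cuts
separating `x` from `y` equals `d(x,y)`, then the metric space has negative type. -/
theorem negativeType_of_crofton {X : Type*} [MetricSpace X]
    [MeasurableSpace X] [BorelSpace X]
    {Ω : Type*} [MeasurableSpace Ω] (σ : Measure Ω)
    (A : Set (Ω × X)) (hA : MeasurableSet A)
    (hcut : ∀ x y : X,
      σ {ω | Xor' ((ω, x) ∈ A) ((ω, y) ∈ A)} = ENNReal.ofReal (dist x y))
    (n : ℕ) (hn : 1 ≤ n) (x : Fin n → X) (α : Fin n → ℝ) (hα : ∑ i, α i = 0) :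
    ∑ i, ∑ j, α i * α j * dist (x i) (x j) ≤ 0 := by
  classical
  let S : X → X → Set Ω := fun y z => {ω | Xor' ((ω, y) ∈ A) ((ω, z) ∈ A)}
  let u : Ω → X → ℝ := fun ω y => if (ω, y) ∈ A then 1 else 0
  have hsection (y : X) : MeasurableSet {ω | (ω, y) ∈ A} :=
    (measurable_id.prodMk measurable_const) hA
  have hS (y z : X) : MeasurableSet (S y z) :=
    ((hsection y).diff (hsection z)).union ((hsection z).diff (hsection y))
  have hind (y z : X) : (S y z).indicator (fun _ => (1 : ℝ)) =
      fun ω => (u ω y - u ω z) ^ 2 := by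
    funext ω
    by_cases hy : (ω, y) ∈ A <;> by_cases hz : (ω, z) ∈ A <;>
      simp [S, u, Set.indicator, Xor', hy, hz]
  have hint (y z : X) : Integrable (fun ω => (u ω y - u ω z) ^ 2) σ := by
    rw [← hind, integrable_indicator_iff (hS y z)]
    exact integrableOn_const ((hcut y z).trans_ne ENNReal.ofReal_ne_top)
  have hdist (y z : X) : dist y z = ∫ ω, (u ω y - u ω z) ^ 2 ∂σ := by
    rw [← hind, integral_indicator_const _ (hS y z)]
    simp [S, measureReal_def, hcut]
  calc
    ∑ i, ∑ j, α i * α j * dist (x i) (x j)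
        = ∫ ω, ∑ i, ∑ j, α i * α j * (u ω (x i) - u ω (x j)) ^ 2 ∂σ := by
      rw [integral_finsetSum _ fun i _ => integrable_finsetSum _ fun j _ =>
        (hint (x i) (x j)).const_mul _]
      refine Finset.sum_congr rfl fun i _ => ?_
      rw [integral_finsetSum _ fun j _ => (hint (x i) (x j)).const_mul _]
      simp only [integral_const_mul, hdist]
    _ ≤ 0 := by
      refine integral_nonpos fun ω => ?_
      have h := sum_sum_mul_sub_sq_of_sum_eq_zero α (fun i => u ω (x i)) hα
      have hsq := sq_nonneg (∑ i, α i * u ω (x i))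
      simp only [Pi.zero_apply]
      linarith
end

section
/- Euclidean space ℝⁿ has strong negative type: it has negative type, and for all Borel probability measures μ₁, μ₂ on ℝⁿ with finite first moment, ∫∫ ‖x−y‖ d(μ₁−μ₂)²(x,y) ≤ 0, with equality only when μ₁ = μ₂. -/
open MeasureTheory

namespace EnergyDistance

open Real Module
open scoped RealInnerProductSpace ComplexConjugate

lemma integrable_id_of_integrable_dist {F : Type*} [NormedAddCommGroup F] [MeasurableSpace F]
    [BorelSpace F] [SecondCountableTopology F] {μ : Measure F} [IsProbabilityMeasure μ]
    (h : ∃ o, Integrable (fun x => dist o x) μ) :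
    Integrable (fun x => x) μ := by
  obtain ⟨o, ho⟩ := h
  refine (ho.add (integrable_const ‖o‖)).mono' (by fun_prop)
    (Filter.Eventually.of_forall fun x => ?_)
  have := norm_le_norm_add_norm_sub o x
  simp only [Pi.add_apply, dist_eq_norm]
  linarith

variable {E : Type*} [NormedAddCommGroup E] [InnerProductSpace ℝ E]

/-- The weight `‖t‖^{-(d+1)}`, `d = dim E`, of the spectral representation of the norm. -/
noncomputable def normWeight (t : E) : ℝ := (‖t‖ ^ (finrank ℝ E + 1))⁻¹

/-- The integrand of the spectral representation `c ‖x‖ = ∫ (1 - cos ⟪x, t⟫) ‖t‖^{-(d+1)} dt`. -/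
noncomputable def normKernel (x t : E) : ℝ := (1 - cos ⟪x, t⟫) * normWeight t

lemma normWeight_nonneg (t : E) : 0 ≤ normWeight t := by
  unfold normWeight; positivity

lemma normWeight_pos {t : E} (ht : t ≠ 0) : 0 < normWeight t := by
  unfold normWeight; positivity

lemma normKernel_nonneg (x t : E) : 0 ≤ normKernel x t :=
  mul_nonneg (sub_nonneg.2 (cos_le_one _)) (normWeight_nonneg t)

lemma sum_sum_normKernel_nonpos {ι : Type*} [Fintype ι] (x : ι → E) (α : ι → ℝ)
    (hα : ∑ i, α i = 0) (t : E) :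
    ∑ i, ∑ j, α i * α j * normKernel (x i - x j) t ≤ 0 := by
  have h : ∑ i, ∑ j, α i * α j * normKernel (x i - x j) t =
      ((∑ i, α i) ^ 2 - (∑ i, α i * cos ⟪x i, t⟫) ^ 2
        - (∑ i, α i * sin ⟪x i, t⟫) ^ 2) * normWeight t := by
    simp_rw [sq, Finset.sum_mul_sum, ← Finset.sum_sub_distrib, Finset.sum_mul]
    refine Finset.sum_congr rfl fun i _ => Finset.sum_congr rfl fun j _ => ?_
    rw [normKernel, inner_sub_left, cos_sub]
    ring
  rw [h, hα]
  refine mul_nonpos_of_nonpos_of_nonneg ?_ (normWeight_nonneg t)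
  nlinarith [sq_nonneg (∑ i, α i * cos ⟪x i, t⟫), sq_nonneg (∑ i, α i * sin ⟪x i, t⟫)]

lemma normKernel_le [FiniteDimensional ℝ E] [Nontrivial E] (x t : E) :
    normKernel x t ≤
      (2 + ‖x‖ ^ 2) * ((1 + ‖t‖ ^ 2)⁻¹ * (‖t‖ ^ (finrank ℝ E - 1))⁻¹) := by
  rcases eq_or_ne t 0 with rfl | ht
  · simp only [normKernel, inner_zero_right, cos_zero, sub_self, zero_mul]
    positivity
  have hpos : 0 < ‖t‖ := norm_pos_iff.2 ht
  obtain ⟨k, hk⟩ : ∃ k, finrank ℝ E = k + 1 :=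
    Nat.exists_eq_succ_of_ne_zero (finrank_pos (R := ℝ) (M := E)).ne'
  have hcos : (1 - cos ⟪x, t⟫) * (1 + ‖t‖ ^ 2) ≤ (2 + ‖x‖ ^ 2) * ‖t‖ ^ 2 := by
    have h₁ : 1 - ⟪x, t⟫ ^ 2 / 2 ≤ cos ⟪x, t⟫ := one_sub_sq_div_two_le_cos
    have h₂ : ⟪x, t⟫ ^ 2 ≤ ‖x‖ ^ 2 * ‖t‖ ^ 2 := by
      rw [← mul_pow, ← sq_abs]
      exact pow_le_pow_left₀ (abs_nonneg _) (abs_real_inner_le_norm x t) 2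
    have h₃ := neg_one_le_cos ⟪x, t⟫
    have h₄ : (1 - cos ⟪x, t⟫) * ‖t‖ ^ 2 ≤ 2 * ‖t‖ ^ 2 := by gcongr; linarith
    nlinarith [sq_nonneg (‖x‖ * ‖t‖)]
  rw [normKernel, normWeight, hk, Nat.add_sub_cancel, ← mul_inv, ← div_eq_mul_inv,
    ← div_eq_mul_inv, div_le_div_iff₀ (by positivity) (by positivity)]
  calc (1 - cos ⟪x, t⟫) * ((1 + ‖t‖ ^ 2) * ‖t‖ ^ k)
      = ((1 - cos ⟪x, t⟫) * (1 + ‖t‖ ^ 2)) * ‖t‖ ^ k := by ring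
    _ ≤ ((2 + ‖x‖ ^ 2) * ‖t‖ ^ 2) * ‖t‖ ^ k := by gcongr
    _ = _ := by ring

variable [MeasurableSpace E]

lemma integrable_norm_sub_prod [FiniteDimensional ℝ E] {μ ν : Measure E} [IsProbabilityMeasure μ]
    [IsProbabilityMeasure ν] (hμ : Integrable (fun x => x) μ) (hν : Integrable (fun x => x) ν) :
    Integrable (fun p : E × E => ‖p.1 - p.2‖) (μ.prod ν) :=
  ((hμ.comp_fst ν).sub (hν.comp_snd μ)).norm

variable [BorelSpace E]

lemma measurable_normWeight : Measurable (normWeight : E → ℝ) := by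
  unfold normWeight; fun_prop

variable [FiniteDimensional ℝ E]

lemma measurable_normKernel_uncurry : Measurable (fun p : E × E => normKernel p.1 p.2) := by
  have h : Measurable (fun p : E × E => cos ⟪p.1, p.2⟫) := by fun_prop
  exact (measurable_const.sub h).mul (measurable_normWeight.comp measurable_snd)

lemma integrable_normKernel [Nontrivial E] (x : E) : Integrable (normKernel x) := by
  have hbound : Integrable
      (fun t : E => (1 + ‖t‖ ^ 2)⁻¹ * (‖t‖ ^ (finrank ℝ E - 1))⁻¹) := by
    refine (integrable_fun_norm_addHaar volume
      (f := fun y : ℝ => (1 + y ^ 2)⁻¹ * (y ^ (finrank ℝ E - 1))⁻¹)).2 ?_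
    refine (integrableOn_congr_fun (fun y hy => ?_) measurableSet_Ioi).2
      integrable_inv_one_add_sq.integrableOn
    have : y ^ (finrank ℝ E - 1) ≠ 0 := pow_ne_zero _ (ne_of_gt hy)
    simp only [smul_eq_mul]
    field_simp
  refine (hbound.const_mul (2 + ‖x‖ ^ 2)).mono'
    (measurable_normKernel_uncurry.comp measurable_prodMk_left).aestronglyMeasurable
    (Filter.Eventually.of_forall fun t => ?_)
  rw [Real.norm_of_nonneg (normKernel_nonneg x t)]
  exact normKernel_le x t

lemma integral_normKernel_eq_of_norm_eq {x y : E} (h : ‖x‖ = ‖y‖) :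
    ∫ t, normKernel x t = ∫ t, normKernel y t := by
  set U : E ≃ₗᵢ[ℝ] E := (ℝ ∙ (x - y))ᗮ.reflection
  have hU : U x = y := Submodule.reflection_sub h
  rw [← U.measurePreserving.integral_comp U.toHomeomorph.measurableEmbedding
    (normKernel y)]
  refine integral_congr_ae (Filter.Eventually.of_forall fun t => ?_)
  simp only [normKernel, normWeight, ← hU, U.norm_map, U.inner_map_map]

lemma integral_normKernel_smul {r : ℝ} (hr : 0 < r) (x : E) :
    ∫ t, normKernel (r • x) t = r * ∫ t, normKernel x t := by
  have h : ∀ t, normKernel (r • x) t = r ^ (finrank ℝ E + 1) * normKernel x (r • t) := by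
    intro t
    simp only [normKernel, normWeight, norm_smul, Real.norm_of_nonneg hr.le, mul_pow,
      real_inner_smul_left, real_inner_smul_right]
    field_simp
  simp_rw [h]
  rw [integral_const_mul, Measure.integral_comp_smul, abs_of_pos (by positivity), smul_eq_mul]
  field_simp
  ring

lemma integral_normKernel_pos [Nontrivial E] {x : E} (hx : ‖x‖ = 1) :
    0 < ∫ t, normKernel x t := by
  refine lt_of_le_of_ne (integral_nonneg (normKernel_nonneg x)) fun h0 => ?_
  have hae := (integral_eq_zero_iff_of_nonneg (normKernel_nonneg x)
    (integrable_normKernel x)).1 h0.symm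
  have hcos : (fun t : E => cos ⟪x, t⟫) =ᵐ[volume] fun _ => 1 := by
    filter_upwards [hae] with t ht
    rcases eq_or_ne t 0 with rfl | h
    · simp
    · have := (mul_eq_zero.1 ht).resolve_right (normWeight_pos h).ne'
      linarith
  have heq := congrFun ((Continuous.ae_eq_iff_eq volume (by fun_prop) continuous_const).1 hcos) x
  have h1 : cos 1 = 1 := by simpa [real_inner_self_eq_norm_sq, hx] using heq
  linarith [cos_one_le]

/-- The spectral representation of the Euclidean norm. -/
theorem exists_integral_normKernel_eq [Nontrivial E] :
    ∃ c : ℝ, 0 < c ∧ ∀ x : E, ∫ t, normKernel x t = c * ‖x‖ := by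
  obtain ⟨e, he⟩ := exists_norm_eq E zero_le_one
  refine ⟨∫ t, normKernel e t, integral_normKernel_pos he, fun x => ?_⟩
  rcases eq_or_ne x 0 with rfl | hx
  · simp [normKernel]
  · rw [integral_normKernel_eq_of_norm_eq (y := ‖x‖ • e) (by simp [norm_smul, he]),
      integral_normKernel_smul (norm_pos_iff.2 hx), mul_comm]

theorem sum_sum_mul_dist_nonpos [Nontrivial E] {ι : Type*} [Fintype ι] (x : ι → E) (α : ι → ℝ)
    (hα : ∑ i, α i = 0) : ∑ i, ∑ j, α i * α j * dist (x i) (x j) ≤ 0 := by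
  obtain ⟨c, hc, hnorm⟩ := exists_integral_normKernel_eq (E := E)
  refine nonpos_of_mul_nonpos_right (a := c) ?_ hc
  have h : c * ∑ i, ∑ j, α i * α j * dist (x i) (x j) =
      ∫ t, ∑ i, ∑ j, α i * α j * normKernel (x i - x j) t := by
    have hint (i j : ι) : Integrable (fun t => α i * α j * normKernel (x i - x j) t) :=
      (integrable_normKernel _).const_mul _
    rw [integral_finsetSum _ fun i _ => integrable_finsetSum _ fun j _ => hint i j,
      Finset.mul_sum]
    refine Finset.sum_congr rfl fun i _ => ?_
    rw [integral_finsetSum _ fun j _ => hint i j, Finset.mul_sum]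
    refine Finset.sum_congr rfl fun j _ => ?_
    rw [integral_const_mul, hnorm, dist_eq_norm]
    ring
  rw [h]
  exact integral_nonpos (sum_sum_normKernel_nonpos x α hα)

lemma integral_prod_cos_inner_sub (μ ν : Measure E) [IsProbabilityMeasure μ]
    [IsProbabilityMeasure ν] (t : E) :
    ∫ p : E × E, cos ⟪p.1 - p.2, t⟫ ∂(μ.prod ν) =
      (charFun μ t * conj (charFun ν t)).re := by
  have hint : Integrable (fun p : E × E =>
      Complex.exp (⟪p.1, t⟫ * Complex.I) * Complex.exp (⟪p.2, -t⟫ * Complex.I)) (μ.prod ν) := by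
    refine (integrable_const (1 : ℝ)).mono' (by fun_prop) (Filter.Eventually.of_forall fun p => ?_)
    rw [norm_mul, Complex.norm_exp_ofReal_mul_I, Complex.norm_exp_ofReal_mul_I, one_mul]
  rw [← charFun_neg, charFun_apply, charFun_apply, ← integral_prod_mul, ← RCLike.re_eq_complex_re,
    ← integral_re hint]
  refine integral_congr_ae (Filter.Eventually.of_forall fun p => ?_)
  simp only [RCLike.re_eq_complex_re]
  rw [← Complex.exp_add, ← add_mul, ← Complex.ofReal_add, Complex.exp_ofReal_mul_I_re,
    inner_neg_right, inner_sub_left, sub_eq_add_neg]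

lemma integral_prod_normKernel_sub (μ ν : Measure E) [IsProbabilityMeasure μ]
    [IsProbabilityMeasure ν] (t : E) :
    ∫ p : E × E, normKernel (p.1 - p.2) t ∂(μ.prod ν) =
      (1 - (charFun μ t * conj (charFun ν t)).re) * normWeight t := by
  have hint : Integrable (fun p : E × E => cos ⟪p.1 - p.2, t⟫) (μ.prod ν) :=
    (integrable_const (1 : ℝ)).mono' (by fun_prop)
      (Filter.Eventually.of_forall fun p => abs_cos_le_one _)
  simp only [normKernel]
  rw [integral_mul_const, integral_sub (integrable_const _) hint, integral_prod_cos_inner_sub]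
  simp

/-- The mean distance of two probability measures in terms of their characteristic functions. -/
lemma mean_norm_sub_eq_integral_charFun [Nontrivial E] {c : ℝ}
    (hc : ∀ x : E, ∫ t, normKernel x t = c * ‖x‖) {μ ν : Measure E} [IsProbabilityMeasure μ]
    [IsProbabilityMeasure ν] (hμ : Integrable (fun x => x) μ) (hν : Integrable (fun x => x) ν) :
    Integrable (fun t => (1 - (charFun μ t * conj (charFun ν t)).re) * normWeight t) ∧
      c * ∫ x, ∫ y, ‖x - y‖ ∂ν ∂μ =
        ∫ t, (1 - (charFun μ t * conj (charFun ν t)).re) * normWeight t := by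
  have hnorm := integrable_norm_sub_prod hμ hν
  have hint : Integrable (Function.uncurry fun (p : E × E) t => normKernel (p.1 - p.2) t)
      ((μ.prod ν).prod volume) := by
    have hmeas : Measurable (Function.uncurry fun (p : E × E) t => normKernel (p.1 - p.2) t) :=
      measurable_normKernel_uncurry.comp
        (f := fun q : (E × E) × E => (q.1.1 - q.1.2, q.2)) (by fun_prop)
    refine (integrable_prod_iff hmeas.aestronglyMeasurable).2
      ⟨Filter.Eventually.of_forall fun p => integrable_normKernel (p.1 - p.2), ?_⟩
    refine (hnorm.const_mul c).congr (Filter.Eventually.of_forall fun p => ?_)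
    beta_reduce
    rw [← hc]
    exact integral_congr_ae (Filter.Eventually.of_forall fun t =>
      (Real.norm_of_nonneg (normKernel_nonneg (p.1 - p.2) t)).symm)
  constructor
  · have h := hint.integral_prod_right
    simpa only [Function.uncurry, integral_prod_normKernel_sub] using h
  · rw [integral_integral hnorm, ← integral_const_mul]
    simp_rw [← hc, ← integral_prod_normKernel_sub]
    exact integral_integral_swap hint

/-- The energy distance is minus the weighted `L²` distance of the characteristic functions. -/
theorem exists_energyDistance_eq [Nontrivial E] : ∃ c : ℝ, 0 < c ∧
    ∀ (μ ν : Measure E) [IsProbabilityMeasure μ] [IsProbabilityMeasure ν],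
      Integrable (fun x => x) μ → Integrable (fun x => x) ν →
      Integrable (fun t => ‖charFun μ t - charFun ν t‖ ^ 2 * normWeight t) ∧
      c * ((∫ x, ∫ y, ‖x - y‖ ∂μ ∂μ) + (∫ x, ∫ y, ‖x - y‖ ∂ν ∂ν)
        - 2 * ∫ x, ∫ y, ‖x - y‖ ∂ν ∂μ) =
        -∫ t, ‖charFun μ t - charFun ν t‖ ^ 2 * normWeight t := by
  obtain ⟨c, hc, hnorm⟩ := exists_integral_normKernel_eq (E := E)
  refine ⟨c, hc, fun μ ν _ _ hμ hν => ?_⟩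
  obtain ⟨i₁, e₁⟩ := mean_norm_sub_eq_integral_charFun hnorm hμ hμ
  obtain ⟨i₂, e₂⟩ := mean_norm_sub_eq_integral_charFun hnorm hν hν
  obtain ⟨i₃, e₃⟩ := mean_norm_sub_eq_integral_charFun hnorm hμ hν
  have hpt (t : E) : ‖charFun μ t - charFun ν t‖ ^ 2 * normWeight t =
      2 * ((1 - (charFun μ t * conj (charFun ν t)).re) * normWeight t)
        - (1 - (charFun μ t * conj (charFun μ t)).re) * normWeight t
        - (1 - (charFun ν t * conj (charFun ν t)).re) * normWeight t := by
    rw [← Complex.normSq_eq_norm_sq, Complex.normSq_sub, Complex.mul_conj, Complex.mul_conj,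
      Complex.ofReal_re, Complex.ofReal_re]
    ring
  simp_rw [hpt]
  have i₄ := (i₃.const_mul 2).sub i₁
  refine ⟨i₄.sub i₂, ?_⟩
  simp only [Pi.sub_def] at i₄
  rw [integral_sub i₄ i₂, integral_sub (i₃.const_mul 2) i₁,
    integral_const_mul, ← e₁, ← e₂, ← e₃]
  ring

lemma eq_of_integral_charFun_sub_eq_zero {μ ν : Measure E} [IsProbabilityMeasure μ]
    [IsProbabilityMeasure ν]
    (hint : Integrable (fun t => ‖charFun μ t - charFun ν t‖ ^ 2 * normWeight t))
    (h : ∫ t, ‖charFun μ t - charFun ν t‖ ^ 2 * normWeight t = 0) : μ = ν := by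
  have hae := (integral_eq_zero_iff_of_nonneg
    (fun t => mul_nonneg (sq_nonneg _) (normWeight_nonneg t)) hint).1 h
  have hcf : charFun μ =ᵐ[volume] charFun ν := by
    filter_upwards [hae] with t ht
    rcases eq_or_ne t 0 with rfl | h
    · simp
    · have := (mul_eq_zero.1 ht).resolve_right (normWeight_pos h).ne'
      exact sub_eq_zero.1 (norm_eq_zero.1 (pow_eq_zero_iff two_ne_zero |>.1 this))
  exact Measure.ext_of_charFun
    ((Continuous.ae_eq_iff_eq volume continuous_charFun continuous_charFun).1 hcf)

end EnergyDistance

open EnergyDistance in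
/-- Euclidean space `ℝⁿ` has strong negative type: it has negative type, and for
all Borel probability measures `μ₁, μ₂` with finite first moment,
`∫∫ ‖x-y‖ d(μ₁-μ₂)² ≤ 0`, with equality only when `μ₁ = μ₂`. -/
theorem euclidean_strongNegativeType (n : ℕ) :
    (∀ (m : ℕ), 1 ≤ m → ∀ (x : Fin m → EuclideanSpace ℝ (Fin n)) (α : Fin m → ℝ),
      ∑ i, α i = 0 → ∑ i, ∑ j, α i * α j * dist (x i) (x j) ≤ 0) ∧
    (∀ (μ₁ μ₂ : Measure (EuclideanSpace ℝ (Fin n))), IsProbabilityMeasure μ₁ →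
      IsProbabilityMeasure μ₂ →
      (∃ o, Integrable (fun x => dist o x) μ₁) →
      (∃ o, Integrable (fun x => dist o x) μ₂) →
      (∫ x, ∫ y, ‖x - y‖ ∂μ₁ ∂μ₁) + (∫ x, ∫ y, ‖x - y‖ ∂μ₂ ∂μ₂)
          - 2 * ∫ x, ∫ y, ‖x - y‖ ∂μ₂ ∂μ₁ ≤ 0 ∧
      ((∫ x, ∫ y, ‖x - y‖ ∂μ₁ ∂μ₁) + (∫ x, ∫ y, ‖x - y‖ ∂μ₂ ∂μ₂)
          - 2 * ∫ x, ∫ y, ‖x - y‖ ∂μ₂ ∂μ₁ = 0 → μ₁ = μ₂)) := by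
  rcases subsingleton_or_nontrivial (EuclideanSpace ℝ (Fin n)) with hE | hE
  · refine ⟨fun m _ x α _ => ?_, fun μ₁ μ₂ _ _ _ _ => ⟨?_, fun _ => ?_⟩⟩
    · simp [Subsingleton.elim (x _) 0]
    · simp [Subsingleton.elim (_ - _ : EuclideanSpace ℝ (Fin n)) 0]
    · exact Measure.ext_of_charFun (funext fun t => by simp [Subsingleton.elim t 0])
  · refine ⟨fun m _ x α hα => sum_sum_mul_dist_nonpos x α hα, fun μ₁ μ₂ _ _ h₁ h₂ => ?_⟩
    obtain ⟨c, hc, henergy⟩ := exists_energyDistance_eq (E := EuclideanSpace ℝ (Fin n))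
    obtain ⟨hint, heq⟩ := henergy μ₁ μ₂ (integrable_id_of_integrable_dist h₁)
      (integrable_id_of_integrable_dist h₂)
    refine ⟨nonpos_of_mul_nonpos_right (a := c) ?_ hc, fun h0 => ?_⟩
    · rw [heq]
      exact neg_nonpos.2 (integral_nonneg fun t => mul_nonneg (sq_nonneg _) (normWeight_nonneg t))
    · rw [h0, mul_zero, zero_eq_neg] at heq
      exact eq_of_integral_charFun_sub_eq_zero hint heq
end

section
/- Euclidean space ℝⁿ has strict negative type: for all m ≥ 1, all pairwise distinct points x₁,…,x_m ∈ ℝⁿ, and all reals α₁,…,α_m with Σᵢ αᵢ = 0, one has Σᵢⱼ αᵢαⱼ ‖xᵢ−xⱼ‖ ≤ 0, with equality only when all αᵢ = 0. -/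
open MeasureTheory ProbabilityTheory Filter Topology

/-- The real part of the characteristic function of the standard Gaussian measure. -/
lemma integral_cos_inner_stdGaussian {n : ℕ} (t : EuclideanSpace ℝ (Fin n)) :
    ∫ z, Real.cos (inner ℝ z t) ∂(stdGaussian (EuclideanSpace ℝ (Fin n))) =
      Real.exp (-‖t‖ ^ 2 / 2) := by
  have h := congrArg Complex.re (charFun_stdGaussian t)
  rw [charFun_apply] at h
  have hint : Integrable (fun z : EuclideanSpace ℝ (Fin n) ↦
      Complex.exp ((inner ℝ z t : ℝ) * Complex.I)) (stdGaussian _) := by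
    refine (integrable_const (1 : ℝ)).mono' (by fun_prop) (ae_of_all _ fun z ↦ ?_)
    rw [Complex.norm_exp_ofReal_mul_I]
  have hre := integral_re hint
  simp only [RCLike.re_eq_complex_re, Complex.exp_ofReal_mul_I_re] at hre
  rw [hre, h]
  norm_cast

/-- The Gaussian kernel is positive semidefinite. -/
lemma sum_mul_exp_neg_norm_sub_sq_nonneg {n : ℕ} {ι : Type*} [Fintype ι]
    (y : ι → EuclideanSpace ℝ (Fin n)) (α : ι → ℝ) :
    0 ≤ ∑ i, ∑ j, α i * α j * Real.exp (-‖y i - y j‖ ^ 2 / 2) := by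
  have hint (t : EuclideanSpace ℝ (Fin n)) :
      Integrable (fun z ↦ Real.cos (inner ℝ z t)) (stdGaussian (EuclideanSpace ℝ (Fin n))) :=
    (integrable_const (1 : ℝ)).mono' (by fun_prop) (ae_of_all _ fun z ↦ Real.abs_cos_le_one _)
  simp_rw [← integral_cos_inner_stdGaussian, ← integral_const_mul]
  simp_rw [← integral_finsetSum Finset.univ fun j _ ↦ (hint _).const_mul _]
  rw [← integral_finsetSum _ fun i _ ↦ integrable_finsetSum _ fun j _ ↦ (hint _).const_mul _]
  refine integral_nonneg fun z ↦ ?_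
  have key : ∑ i, ∑ j, α i * α j * Real.cos (inner ℝ z (y i - y j)) =
      (∑ i, α i * Real.cos (inner ℝ z (y i))) ^ 2 +
        (∑ i, α i * Real.sin (inner ℝ z (y i))) ^ 2 := by
    simp_rw [sq, Finset.sum_mul_sum, ← Finset.sum_add_distrib, inner_sub_right, Real.cos_sub]
    refine Finset.sum_congr rfl fun i _ ↦ Finset.sum_congr rfl fun j _ ↦ ?_
    ring
  simp only [Pi.zero_apply, key]
  positivity

lemma integrable_one_sub_exp_neg_sq_div_sq :
    Integrable fun t : ℝ ↦ (1 - Real.exp (-t ^ 2)) / t ^ 2 := by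
  refine (integrable_inv_one_add_sq.const_mul 2).mono'
    (Measurable.aestronglyMeasurable (by fun_prop)) (ae_of_all _ fun t ↦ ?_)
  have h1 : Real.exp (-t ^ 2) ≤ 1 := Real.exp_le_one_iff.2 (by nlinarith [sq_nonneg t])
  have h2 := Real.add_one_le_exp (-t ^ 2)
  have h3 := Real.exp_pos (-t ^ 2)
  rw [Real.norm_of_nonneg (div_nonneg (by linarith) (sq_nonneg t)), ← div_eq_mul_inv]
  rcases eq_or_ne t 0 with rfl | ht
  · simp
  rw [div_le_div_iff₀ (by positivity) (by positivity)]
  nlinarith [mul_nonneg (sq_nonneg t) h3.le]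

lemma integral_one_sub_exp_neg_sq_div_sq_pos :
    0 < ∫ t : ℝ, (1 - Real.exp (-t ^ 2)) / t ^ 2 := by
  have hexp (t : ℝ) : Real.exp (-t ^ 2) ≤ 1 := Real.exp_le_one_iff.2 (by nlinarith [sq_nonneg t])
  rw [integral_pos_iff_support_of_nonneg
    (fun t ↦ div_nonneg (sub_nonneg.2 (hexp t)) (sq_nonneg t))
    integrable_one_sub_exp_neg_sq_div_sq]
  refine lt_of_lt_of_le (by simp : 0 < volume (Set.Ioi (0 : ℝ))) (measure_mono fun t ht ↦ ?_)
  have ht : 0 < t := ht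
  have : Real.exp (-t ^ 2) < 1 := Real.exp_lt_one_iff.2 (by nlinarith)
  exact (div_pos (sub_pos.2 this) (by positivity)).ne'

lemma one_sub_exp_neg_mul_sq_div_sq (r t : ℝ) :
    (1 - Real.exp (-(r * t) ^ 2)) / t ^ 2 =
      r ^ 2 * ((1 - Real.exp (-(r * t) ^ 2)) / (r * t) ^ 2) := by
  rcases eq_or_ne r 0 with rfl | hr
  · simp
  rcases eq_or_ne t 0 with rfl | ht
  · simp
  field_simp

lemma integrable_one_sub_exp_neg_mul_sq_div_sq (r : ℝ) :
    Integrable fun t : ℝ ↦ (1 - Real.exp (-(r * t) ^ 2)) / t ^ 2 := by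
  rcases eq_or_ne r 0 with rfl | hr
  · simp
  simp_rw [one_sub_exp_neg_mul_sq_div_sq r]
  exact (integrable_one_sub_exp_neg_sq_div_sq.comp_mul_left' hr).const_mul _

lemma integral_one_sub_exp_neg_mul_sq_div_sq {r : ℝ} (hr : 0 ≤ r) :
    ∫ t : ℝ, (1 - Real.exp (-(r * t) ^ 2)) / t ^ 2 =
      r * ∫ t : ℝ, (1 - Real.exp (-t ^ 2)) / t ^ 2 := by
  rcases hr.eq_or_lt with rfl | hr
  · simp
  simp_rw [one_sub_exp_neg_mul_sq_div_sq r]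
  rw [integral_const_mul,
    Measure.integral_comp_mul_left (fun t : ℝ ↦ (1 - Real.exp (-t ^ 2)) / t ^ 2) r,
    abs_of_pos (inv_pos.2 hr), smul_eq_mul]
  field_simp

/-- For distinct points the Gaussian kernel tends to the identity matrix as its width shrinks. -/
lemma tendsto_sum_mul_exp_neg_norm_sub_mul_sq {E ι : Type*} [NormedAddCommGroup E] [Fintype ι]
    {x : ι → E} (hx : Function.Injective x) (α : ι → ℝ) :
    Tendsto (fun t : ℝ ↦ ∑ i, ∑ j, α i * α j * Real.exp (-(‖x i - x j‖ * t) ^ 2)) atTop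
      (𝓝 (∑ i, α i ^ 2)) := by
  classical
  have hsum : ∑ i, α i ^ 2 = ∑ i, ∑ j, α i * α j * (if i = j then 1 else 0) := by
    simp [sq]
  rw [hsum]
  refine tendsto_finsetSum _ fun i _ ↦ tendsto_finsetSum _ fun j _ ↦ Tendsto.const_mul _ ?_
  split_ifs with hij
  · simp [hij]
  · have hpos : 0 < ‖x i - x j‖ := norm_pos_iff.2 (sub_ne_zero.2 (hx.ne hij))
    exact Real.tendsto_exp_neg_atTop_nhds_zero.comp
      ((tendsto_pow_atTop two_ne_zero).comp (tendsto_id.const_mul_atTop hpos))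

/-- Euclidean space `ℝⁿ` has strict negative type: for pairwise distinct points
and reals summing to zero, `∑ᵢⱼ αᵢαⱼ ‖xᵢ - xⱼ‖ ≤ 0`, with equality only when all
coefficients vanish. -/
theorem euclidean_strictNegativeType (n : ℕ) (m : ℕ) (hm : 1 ≤ m)
    (x : Fin m → EuclideanSpace ℝ (Fin n)) (hx : Function.Injective x)
    (α : Fin m → ℝ) (hα : ∑ i, α i = 0) :
    ∑ i, ∑ j, α i * α j * ‖x i - x j‖ ≤ 0 ∧
    (∑ i, ∑ j, α i * α j * ‖x i - x j‖ = 0 → ∀ i, α i = 0) := by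
  set C := ∫ t : ℝ, (1 - Real.exp (-t ^ 2)) / t ^ 2 with hC
  have hCpos : 0 < C := integral_one_sub_exp_neg_sq_div_sq_pos
  let G : ℝ → ℝ := fun t ↦ ∑ i, ∑ j, α i * α j * Real.exp (-(‖x i - x j‖ * t) ^ 2)
  have hG (t : ℝ) : 0 ≤ G t := by
    convert sum_mul_exp_neg_norm_sub_sq_nonneg (fun i ↦ (√2 * t) • x i) α using 7 with i _ j
    rw [← smul_sub, norm_smul, mul_pow, mul_pow, Real.norm_eq_abs, sq_abs, mul_pow,
      Real.sq_sqrt zero_le_two]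
    ring
  have hterm (i j : Fin m) : Integrable fun t : ℝ ↦
      α i * α j * ((1 - Real.exp (-(‖x i - x j‖ * t) ^ 2)) / t ^ 2) :=
    (integrable_one_sub_exp_neg_mul_sq_div_sq _).const_mul _
  have hsum (t : ℝ) : ∑ i, ∑ j, α i * α j * ((1 - Real.exp (-(‖x i - x j‖ * t) ^ 2)) / t ^ 2) =
      -(G t / t ^ 2) := by
    have hzero : ∑ i, ∑ j, α i * α j = 0 := by
      rw [← Finset.sum_mul_sum, hα, zero_mul]
    simp_rw [mul_div_assoc', ← Finset.sum_div, mul_sub, mul_one, Finset.sum_sub_distrib]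
    rw [hzero, zero_sub, neg_div]
  have hint : Integrable fun t ↦ G t / t ^ 2 := by
    have h := integrable_finsetSum Finset.univ fun i _ ↦
      integrable_finsetSum Finset.univ fun j _ ↦ hterm i j
    simp_rw [hsum] at h
    simpa using h.neg
  have hrep : (∑ i, ∑ j, α i * α j * ‖x i - x j‖) * C = -∫ t, G t / t ^ 2 := by
    rw [← integral_neg]
    simp_rw [← hsum]
    rw [integral_finsetSum _ fun i _ ↦ integrable_finsetSum _ fun j _ ↦ hterm i j]
    simp_rw [integral_finsetSum Finset.univ fun j _ ↦ hterm _ j, integral_const_mul,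
      integral_one_sub_exp_neg_mul_sq_div_sq (norm_nonneg _), Finset.sum_mul, mul_assoc, ← hC]
  have hnonneg : 0 ≤ fun t ↦ G t / t ^ 2 := fun t ↦ div_nonneg (hG t) (sq_nonneg t)
  refine ⟨nonpos_of_mul_nonpos_left (hrep ▸ neg_nonpos.2 (integral_nonneg hnonneg)) hCpos, ?_⟩
  intro h0
  rw [h0, zero_mul, eq_comm, neg_eq_zero, integral_eq_zero_iff_of_nonneg hnonneg hint] at hrep
  by_contra! hne
  obtain ⟨k, hk⟩ := hne
  have hpos : 0 < ∑ i, α i ^ 2 :=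
    Finset.sum_pos' (fun i _ ↦ sq_nonneg _) ⟨k, Finset.mem_univ k, by positivity⟩
  obtain ⟨T, hT⟩ := eventually_atTop.1
    (((tendsto_sum_mul_exp_neg_norm_sub_mul_sq hx α).eventually_const_lt hpos).and
      (eventually_gt_atTop 0))
  have hnull : volume (Set.Ici T) = 0 := measure_mono_null
    (fun t ht ↦ (div_pos (hT t ht).1 (pow_pos (hT t ht).2 2)).ne') (ae_iff.1 hrep)
  simp at hnull
end
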